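/- Let d ≥ 1, 1 ≤ p < ∞, r ∈ ℕ with r ≥ 2, α ∈ (0,1), and let f ∈ L_p(ℝ^d) satisfy Σ_{k∈ℤ^d} |f(σ^{−1}k)|^p < ∞ for every σ > 0. Then the following are equivalent as σ → ∞: (i) ‖f − S_σ^{β_r} f‖_{L_p(ℝ^d)} = O(σ^{−α}); (ii) ‖f_{1/(2σ),r} − f‖_{ℓ_p(X_σ)} + ω_1(f,σ^{−1})_p = O(σ^{−α}). -/

import Mathlib

open MeasureTheory ENNReal Metric Filter
open scoped BigOperators FourierTransform

noncomputable section

/-- Euclidean space ℝ^d. -/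
abbrev Euc (d : ℕ) := EuclideanSpace ℝ (Fin d)

/-- The `L_p(ℝ^d)` (quasi-)norm, valued in `ℝ≥0∞`. -/
def LpN {d : ℕ} (p : ℝ) (f : Euc d → ℝ) : ℝ≥0∞ :=
  eLpNorm f (ENNReal.ofReal p) volume

/-- Membership `f ∈ L_p(ℝ^d)`. -/
def MemLpR {d : ℕ} (p : ℝ) (f : Euc d → ℝ) : Prop :=
  AEStronglyMeasurable f volume ∧ LpN p f ≠ ∞

/-- The difference operator `Δ_h^r f`. -/
def diffOp {d : ℕ} (h : Euc d) (r : ℕ) (f : Euc d → ℝ) : Euc d → ℝ :=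
  fun x => ∑ ν ∈ Finset.range (r + 1),
    (r.choose ν : ℝ) * (-1 : ℝ) ^ ν * f (x + ((r - ν : ℕ) : ℝ) • h)

/-- The modulus of smoothness `ω_r(f,δ)_p`. -/
def smod {d : ℕ} (p : ℝ) (r : ℕ) (f : Euc d → ℝ) (δ : ℝ) : ℝ≥0∞ :=
  ⨆ (h : Euc d) (_ : ‖h‖ < δ), LpN p (diffOp h r f)

/-- The discrete semi-norm `‖f‖_{ℓ_p(X_σ)} = (σ^{-d} ∑_{ξ∈X} |f(ξ)|^p)^{1/p}`. -/
def lpX {d : ℕ} (p σ : ℝ) (X : Set (Euc d)) (f : Euc d → ℝ) : ℝ≥0∞ :=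
  ((ENNReal.ofReal σ)⁻¹ ^ d * ∑' ξ : X, ENNReal.ofReal (|f ξ.1| ^ p)) ^ (1 / p)

/-- Separation property of the sampling set: distinct points of `X` are at distance `> 2γ/σ`. -/
def Separated {d : ℕ} (γ σ : ℝ) (X : Set (Euc d)) : Prop :=
  ∀ ξ ∈ X, ∀ ξ' ∈ X, ξ ≠ ξ' → 2 * γ / σ < dist ξ ξ'

/-- Ball average `f_δ(x) = |B_δ|⁻¹ ∫_{B_δ(x)} f`. -/
def ballAvg {d : ℕ} (f : Euc d → ℝ) (δ : ℝ) (x : Euc d) : ℝ :=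
  ⨍ y in ball x δ, f y

/-- The special averaged operator `f_{δ,r}`. -/
def avgOp {d : ℕ} (f : Euc d → ℝ) (δ : ℝ) (r : ℕ) : Euc d → ℝ := fun x =>
  -(2 / ((2 * r).choose r : ℝ)) *
    ∑ j ∈ Finset.Icc 1 r,
      (-1 : ℝ) ^ j * ((2 * r).choose (r - j) : ℝ) * ballAvg f (δ * j / r) x

/-- The local modulus of smoothness `ω_r(f,x,δ)` (valued in `ℝ≥0∞`). -/
def localMod {d : ℕ} (r : ℕ) (f : Euc d → ℝ) (x : Euc d) (δ : ℝ) : ℝ≥0∞ :=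
  ⨆ (t : Euc d) (h : Euc d)
    (_ : t ∈ ball x ((r : ℝ) * δ / 2) ∧ t + (r : ℝ) • h ∈ ball x ((r : ℝ) * δ / 2)),
      ENNReal.ofReal |diffOp h r f t|

/-- The averaged modulus of smoothness (`τ`-modulus) `τ_r(f,δ)_p`. -/
def tauMod {d : ℕ} (p : ℝ) (r : ℕ) (f : Euc d → ℝ) (δ : ℝ) : ℝ≥0∞ :=
  (∫⁻ x, localMod r f x δ ^ p) ^ (1 / p)

/-- First-order partial derivative in the `i`-th coordinate direction. -/
def pderiv' {d : ℕ} (i : Fin d) (f : Euc d → ℝ) : Euc d → ℝ :=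
  fun x => fderiv ℝ f x (EuclideanSpace.single i 1)

/-- The mixed partial derivative `D^α` for a multi-index `α`. -/
def Dmulti {d : ℕ} (α : Fin d → ℕ) (f : Euc d → ℝ) : Euc d → ℝ :=
  ((List.ofFn fun i : Fin d => (pderiv' i)^[α i]).foldr (· ∘ ·) id) f

/-- The Sobolev semi-norm `|f|_{W_p^s} = ∑_{|α|₁ = s} ‖D^α f‖_p`. -/
def sobolevSemi {d : ℕ} (p : ℝ) (s : ℕ) (f : Euc d → ℝ) : ℝ≥0∞ :=
  ∑' α : {α : Fin d → ℕ // ∑ i, α i = s}, LpN p (Dmulti α.1 f)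

/-- Membership in the Sobolev space `W_p^s(ℝ^d)`. -/
def MemSobolev {d : ℕ} (p : ℝ) (s : ℕ) (f : Euc d → ℝ) : Prop :=
  MemLpR p f ∧ ∀ α : Fin d → ℕ, (∑ i, α i) ≤ s → MemLpR p (Dmulti α f)

/-- The class of band-limited functions `B_p^σ(ℝ^d)`:
functions in `L_p ∩ L_1` whose Fourier transform is supported in `[-σ,σ]^d`. -/
def MemBandlimited {d : ℕ} (p σ : ℝ) (φ : Euc d → ℝ) : Prop :=
  MemLpR p φ ∧ Integrable φ ∧
    Function.support (𝓕 fun x : Euc d => (φ x : ℂ)) ⊆ {ξ : Euc d | ∀ i, |ξ i| ≤ σ}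

/-- Assumption (A₁): `‖G f‖_p ≤ κ ‖f‖_{ℓ_p(X_σ)}` for `f ∈ L_p ∩ ℓ_p(X_σ)`. -/
def AssumpA1 {d : ℕ} (p σ : ℝ) (X : Set (Euc d)) (G : (Euc d → ℝ) → Euc d → ℝ)
    (κ : ℝ≥0∞) : Prop :=
  ∀ f : Euc d → ℝ, MemLpR p f → lpX p σ X f ≠ ∞ → LpN p (G f) ≤ κ * lpX p σ X f

/-- Assumption (A₂): `κ ‖f‖_{ℓ_p(X_σ)} ≤ ‖G f‖_p` for `f ∈ L_p ∩ ℓ_p(X_σ)`. -/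
def AssumpA2 {d : ℕ} (p σ : ℝ) (X : Set (Euc d)) (G : (Euc d → ℝ) → Euc d → ℝ)
    (κ : ℝ≥0∞) : Prop :=
  ∀ f : Euc d → ℝ, MemLpR p f → lpX p σ X f ≠ ∞ → κ * lpX p σ X f ≤ LpN p (G f)

/-- Assumption (A₃): `‖g - G g‖_p ≤ κ σ^{-s} |g|_{W_p^s}` for all `g ∈ B_p^{λσ}(ℝ^d)`. -/
def AssumpA3 {d : ℕ} (p σ : ℝ) (G : (Euc d → ℝ) → Euc d → ℝ) (s : ℕ) (lam : ℝ)
    (κ : ℝ≥0∞) : Prop :=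
  ∀ g : Euc d → ℝ, MemBandlimited p (lam * σ) g →
    LpN p (g - G g) ≤ κ * (ENNReal.ofReal σ)⁻¹ ^ s * sobolevSemi p s g

/-- The error of best approximation `E(f,Φ)_p`. -/
def bestApprox {d : ℕ} (p : ℝ) (Φ : Set (Euc d → ℝ)) (f : Euc d → ℝ) : ℝ≥0∞ :=
  ⨅ (g : Euc d → ℝ) (_ : g ∈ Φ), LpN p (f - g)

/-- Structural properties of the family of approximation subspaces `Φ = (Φ_σ)_{σ ≥ 0}`. -/
def PhiFamily {d : ℕ} (Φ : ℝ → Set (Euc d → ℝ)) : Prop :=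
  (∀ σ : ℝ, 0 < σ → (0 : Euc d → ℝ) ∈ Φ σ) ∧
  Φ 0 = {0} ∧
  (∀ a : ℝ, a ≠ 0 → ∀ σ : ℝ, 0 < σ → (fun g : Euc d → ℝ => a • g) '' Φ σ = Φ σ) ∧
  (∃ c : ℝ, 0 < c ∧ ∀ σ : ℝ, 0 < σ → ∀ g₁ ∈ Φ σ, ∀ g₂ ∈ Φ σ, g₁ + g₂ ∈ Φ (c * σ))

/-- Jackson-type inequality for the family `Φ`:
`E(f,Φ_σ)_p ≤ c σ^{-s} |f|_{W_p^s}` for `f ∈ W_p^s`. -/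
def JacksonIneq {d : ℕ} (p : ℝ) (s : ℕ) (Φ : ℝ → Set (Euc d → ℝ)) (c : ℝ≥0∞) : Prop :=
  ∀ σ : ℝ, 0 < σ → ∀ f : Euc d → ℝ, MemSobolev p s f →
    bestApprox p (Φ σ) f ≤ c * (ENNReal.ofReal σ)⁻¹ ^ s * sobolevSemi p s f

/-- Bernstein-type inequality for the family `Φ`:
`|g|_{W_p^s} ≤ c σ^s ‖g‖_p` for `g ∈ Φ_σ ∩ W_p^s`. -/
def BernsteinIneq {d : ℕ} (p : ℝ) (s : ℕ) (Φ : ℝ → Set (Euc d → ℝ)) (c : ℝ≥0∞) : Prop :=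
  ∀ σ : ℝ, 0 < σ → ∀ g ∈ Φ σ, MemSobolev p s g →
    sobolevSemi p s g ≤ c * (ENNReal.ofReal σ) ^ s * LpN p g

/-- The semi-discrete K-functional `𝒦_s(f,X_σ)_p`. -/
def Kfun {d : ℕ} (p : ℝ) (s : ℕ) (σ : ℝ) (X : Set (Euc d)) (f : Euc d → ℝ) : ℝ≥0∞ :=
  ⨅ (g : Euc d → ℝ) (_ : MemSobolev p s g),
    lpX p σ X (f - g) + LpN p (f - g) + (ENNReal.ofReal σ)⁻¹ ^ s * sobolevSemi p s g

/-- `F σ = O(σ^{-α})` as `σ → ∞`, for `ℝ≥0∞`-valued quantities. -/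
def BigO (F : ℝ → ℝ≥0∞) (α : ℝ) : Prop :=
  ∃ C : ℝ≥0∞, C ≠ ∞ ∧ ∀ᶠ σ : ℝ in atTop, F σ ≤ C * ENNReal.ofReal (σ ^ (-α))

/-- The grid point `σ⁻¹ k ∈ ℝ^d` for `k ∈ ℤ^d`. -/
def gridPt {d : ℕ} (σ : ℝ) (k : Fin d → ℤ) : Euc d :=
  (EuclideanSpace.equiv (Fin d) ℝ).symm fun i => (k i : ℝ) / σ

/-- The generalized sampling operator `S_σ^φ f(x) = ∑_{k∈ℤ^d} f(σ⁻¹k) φ(σx - k)`. -/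
def samplingOp {d : ℕ} (φ : Euc d → ℝ) (σ : ℝ) (f : Euc d → ℝ) : Euc d → ℝ :=
  fun x => ∑' k : Fin d → ℤ, f (gridPt σ k) * φ (σ • x - gridPt 1 k)

/-- The univariate `sinc` function. -/
def sinc1 (t : ℝ) : ℝ := if t = 0 then 1 else Real.sin (Real.pi * t) / (Real.pi * t)

/-- The multivariate `sinc` kernel. -/
def sincKer {d : ℕ} (x : Euc d) : ℝ := ∏ j : Fin d, sinc1 (x j)

/-- The univariate B-spline of order `r`. -/
def Bspline (r : ℕ) (u : ℝ) : ℝ :=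
  (1 / ((r - 1).factorial : ℝ)) * ∑ j ∈ Finset.range (r + 1),
    (-1 : ℝ) ^ j * (r.choose j : ℝ) * max ((r : ℝ) / 2 + u - j) 0 ^ (r - 1)

/-- The tensor-product B-spline kernel `β_r`. -/
def BsplineKer {d : ℕ} (r : ℕ) (x : Euc d) : ℝ := ∏ j : Fin d, Bspline r (x j)

/-- The Gaussian kernel `ψ(x) = e^{-π|x|²}`. -/
def gaussKer {d : ℕ} (x : Euc d) : ℝ := Real.exp (-(Real.pi * ‖x‖ ^ 2))

/-- The truncated power `v_+^n / n!`. -/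
def truncPow (n : ℕ) (v : ℝ) : ℝ := max v 0 ^ n / n.factorial

lemma truncPow_of_nonpos {n : ℕ} (hn : n ≠ 0) {v : ℝ} (hv : v ≤ 0) : truncPow n v = 0 := by
  simp [truncPow, max_eq_right hv, hn]

lemma truncPow_of_nonneg {n : ℕ} {v : ℝ} (hv : 0 ≤ v) :
    truncPow n v = (n.factorial : ℝ)⁻¹ * v ^ n := by
  rw [truncPow, max_eq_left hv]; ring

lemma continuous_truncPow (n : ℕ) : Continuous (truncPow n) := by
  unfold truncPow; fun_prop

lemma fwdDiff_iter_apply (f : ℝ → ℝ) (n : ℕ) (y : ℝ) :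
    (fwdDiff (1 : ℝ))^[n] f y =
      ∑ k ∈ Finset.range (n + 1), (-1 : ℝ) ^ (n - k) * n.choose k * f (y + k) := by
  rw [fwdDiff_iter_eq_sum_shift]
  refine Finset.sum_congr rfl fun k _ => ?_
  simp [zsmul_eq_mul]

lemma fwdDiff_iter_congr {f g : ℝ → ℝ} {n : ℕ} {y : ℝ}
    (h : ∀ k : ℕ, k ≤ n → f (y + k) = g (y + k)) :
    (fwdDiff (1 : ℝ))^[n] f y = (fwdDiff (1 : ℝ))^[n] g y := by
  rw [fwdDiff_iter_apply, fwdDiff_iter_apply]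
  refine Finset.sum_congr rfl fun k hk => ?_
  rw [h k (by simpa [Nat.lt_succ_iff] using hk)]

lemma fwdDiff_iter_const_mul_pow (n m : ℕ) (c y : ℝ) :
    (fwdDiff (1 : ℝ))^[m] (fun v => c * v ^ n) y =
      c * (fwdDiff (1 : ℝ))^[m] (fun v => v ^ n) y := by
  rw [fwdDiff_iter_apply, fwdDiff_iter_apply, Finset.mul_sum]
  exact Finset.sum_congr rfl fun k _ => by ring

lemma Bspline_eq_fwdDiff (r : ℕ) (u : ℝ) :
    Bspline r u = (fwdDiff (1 : ℝ))^[r] (truncPow (r - 1)) (u - r / 2) := by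
  rw [fwdDiff_iter_apply, Bspline, Finset.mul_sum, ← Finset.sum_range_reflect]
  refine Finset.sum_congr rfl fun k hk => ?_
  have hk' : k ≤ r := by simpa [Nat.lt_succ_iff] using hk
  have e : r + 1 - 1 - k = r - k := by omega
  rw [e, Nat.choose_symm hk', truncPow, Nat.cast_sub hk',
    show (r : ℝ) / 2 + u - (r - k) = u - r / 2 + k by ring]
  ring

lemma Bspline_eq_zero {r : ℕ} (hr : 2 ≤ r) {u : ℝ} (hu : (r : ℝ) / 2 ≤ |u|) :
    Bspline r u = 0 := by
  rw [Bspline_eq_fwdDiff]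
  rcases le_abs'.1 hu with h | h
  · rw [fwdDiff_iter_apply]
    refine Finset.sum_eq_zero fun k hk => ?_
    have hk' : (k : ℝ) ≤ r := by exact_mod_cast Finset.mem_range_succ_iff.1 hk
    rw [truncPow_of_nonpos (by omega) (by linarith), mul_zero]
  · rw [fwdDiff_iter_congr (g := fun v => ((r - 1).factorial : ℝ)⁻¹ * v ^ (r - 1)),
      fwdDiff_iter_const_mul_pow, fwdDiff_iter_pow_eq_zero_of_lt (by omega)]
    · simp
    · intro k _
      have : (0 : ℝ) ≤ k := k.cast_nonneg
      exact truncPow_of_nonneg (by linarith)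

lemma continuous_Bspline (r : ℕ) : Continuous (Bspline r) := by
  unfold Bspline; fun_prop

lemma sum_Icc_int_telescope (F : ℤ → ℝ) (N : ℕ) :
    ∑ j ∈ Finset.Icc (-N : ℤ) N, (F (-j + 1) - F (-j)) = F (N + 1) - F (-N) := by
  induction N with
  | zero => simp
  | succ N ih =>
    have h : Finset.Icc (-((N + 1 : ℕ) : ℤ)) ((N + 1 : ℕ) : ℤ) =
        insert (-((N : ℤ) + 1)) (insert ((N : ℤ) + 1) (Finset.Icc (-N : ℤ) N)) := by
      ext j; simp only [Finset.mem_Icc, Finset.mem_insert]; push_cast; omega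
    rw [h, Finset.sum_insert, Finset.sum_insert, ih]
    · push_cast
      rw [neg_neg, show -((N : ℤ) + 1) + 1 = -N by ring]; ring
    · simp
    · simp only [Finset.mem_Icc, Finset.mem_insert]; omega

lemma sum_Bspline_shift {r N : ℕ} (hr : 2 ≤ r) (hN : 2 * r ≤ N) {t : ℝ}
    (ht : t ∈ Set.Icc (-1 : ℝ) 2) :
    ∑ j ∈ Finset.Icc (-N : ℤ) N, Bspline r (t - j) = 1 := by
  obtain ⟨n, rfl⟩ : ∃ n, r = n + 1 := ⟨r - 1, by omega⟩
  set D := (fwdDiff (1 : ℝ))^[n] (truncPow n) with hD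
  set s := t - ((n + 1 : ℕ) : ℝ) / 2 with hs
  have hN' : 2 * ((n : ℝ) + 1) ≤ N := by exact_mod_cast hN
  have hn' : (1 : ℝ) ≤ n := by exact_mod_cast (by omega : 1 ≤ n)
  have key : ∀ j : ℤ, Bspline (n + 1) (t - j) =
      (fun i : ℤ => D (s + i)) (-j + 1) - (fun i : ℤ => D (s + i)) (-j) := by
    intro j
    rw [Bspline_eq_fwdDiff, Function.iterate_succ_apply', fwdDiff]
    simp only [hD, hs, Nat.add_sub_cancel]
    push_cast
    congr 2 <;> ring_nf
  rw [Finset.sum_congr rfl fun j _ => key j,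
    sum_Icc_int_telescope (fun i : ℤ => D (s + i))]
  have h1 : D (s + ((-N : ℤ) : ℝ)) = 0 := by
    rw [hD, fwdDiff_iter_apply]
    refine Finset.sum_eq_zero fun k hk => ?_
    have hk' : (k : ℝ) ≤ n := by exact_mod_cast Finset.mem_range_succ_iff.1 hk
    have := ht.2
    rw [truncPow_of_nonpos (by omega), mul_zero]
    simp only [hs]; push_cast; linarith
  have h2 : D (s + (((N : ℤ) + 1 : ℤ) : ℝ)) = 1 := by
    rw [hD, fwdDiff_iter_congr (g := fun v => (n.factorial : ℝ)⁻¹ * v ^ n),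
      fwdDiff_iter_const_mul_pow, fwdDiff_iter_eq_factorial]
    · have : (n.factorial : ℝ) ≠ 0 := by positivity
      simp [this]
    · intro k _
      have : (0 : ℝ) ≤ k := k.cast_nonneg
      have := ht.1
      refine truncPow_of_nonneg ?_
      simp only [hs]; push_cast; linarith
  simp only [h1, h2, sub_zero]

lemma exists_Bspline_lipschitz {r : ℕ} (hr : 2 ≤ r) :
    ∃ L : ℝ, 0 ≤ L ∧ ∀ u v : ℝ, |Bspline r u - Bspline r v| ≤ L * |u - v| := by
  have hT : ∀ j ∈ Finset.range (r + 1), ∀ u v : ℝ, |u| ≤ r / 2 → |v| ≤ r / 2 →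
      |(-1 : ℝ) ^ j * (r.choose j : ℝ) * max ((r : ℝ) / 2 + u - j) 0 ^ (r - 1) -
        (-1 : ℝ) ^ j * (r.choose j : ℝ) * max ((r : ℝ) / 2 + v - j) 0 ^ (r - 1)| ≤
      (r.choose j : ℝ) * ((r - 1 : ℕ) * (r : ℝ) ^ (r - 1 - 1)) * |u - v| := by
    intro j _ u v hu hv
    have hj : (0 : ℝ) ≤ j := j.cast_nonneg
    have hr0 : (0 : ℝ) ≤ r := r.cast_nonneg
    rw [← mul_sub, abs_mul, abs_mul, abs_pow, abs_neg, abs_one, one_pow, one_mul, Nat.abs_cast,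
      mul_assoc]
    refine mul_le_mul_of_nonneg_left ?_ (Nat.cast_nonneg _)
    refine (abs_pow_sub_pow_le _ _ _).trans ?_
    have h1 : |max ((r : ℝ) / 2 + u - j) 0 - max ((r : ℝ) / 2 + v - j) 0| ≤ |u - v| := by
      refine (abs_max_sub_max_le_abs _ _ _).trans_eq ?_
      congr 1; ring
    have h2 : ∀ w : ℝ, |w| ≤ r / 2 → |max ((r : ℝ) / 2 + w - j) 0| ≤ r := by
      intro w hw
      rw [abs_of_nonneg (le_max_right _ _)]
      exact max_le (by linarith [le_abs_self w]) hr0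
    have h3 := max_le (h2 u hu) (h2 v hv)
    calc _ ≤ |u - v| * ((r - 1 : ℕ) : ℝ) * (r : ℝ) ^ (r - 1 - 1) := by gcongr
      _ = _ := by ring
  have hloc : ∃ L : ℝ, 0 ≤ L ∧ ∀ u v : ℝ, |u| ≤ r / 2 → |v| ≤ r / 2 →
      |Bspline r u - Bspline r v| ≤ L * |u - v| := by
    refine ⟨1 / ((r - 1).factorial : ℝ) * ∑ j ∈ Finset.range (r + 1),
      (r.choose j : ℝ) * ((r - 1 : ℕ) * (r : ℝ) ^ (r - 1 - 1)), by positivity, ?_⟩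
    intro u v hu hv
    rw [Bspline, Bspline, ← mul_sub, abs_mul, ← Finset.sum_sub_distrib, mul_assoc,
      Finset.sum_mul, abs_of_nonneg (by positivity)]
    gcongr
    exact (Finset.abs_sum_le_sum_abs _ _).trans
      (Finset.sum_le_sum fun j hj => hT j hj u v hu hv)
  obtain ⟨L, hL0, hL⟩ := hloc
  have hr0 : (0 : ℝ) ≤ r / 2 := by positivity
  set cl : ℝ → ℝ := fun u => max (min u (r / 2)) (-(r / 2)) with hcl
  have hcl_le : ∀ u, |cl u| ≤ r / 2 := fun u =>
    abs_le.2 ⟨le_max_right _ _, max_le (min_le_right _ _) (by linarith)⟩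
  have hcl_B : ∀ u, Bspline r (cl u) = Bspline r u := by
    intro u
    by_cases h : |u| ≤ r / 2
    · have := abs_le.1 h
      simp only [hcl]
      rw [min_eq_left this.2, max_eq_left this.1]
    · have h' : (r : ℝ) / 2 ≤ |u| := (not_le.1 h).le
      rw [Bspline_eq_zero hr h', Bspline_eq_zero hr]
      rcases le_abs'.1 h' with h1 | h1
      · simp only [hcl]
        rw [min_eq_left (by linarith), max_eq_right (by linarith), abs_neg]
        exact le_abs_self _
      · simp only [hcl]
        rw [min_eq_right h1, max_eq_left (by linarith)]
        exact le_abs_self _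
  refine ⟨L, hL0, fun u v => ?_⟩
  rw [← hcl_B u, ← hcl_B v]
  refine (hL _ _ (hcl_le u) (hcl_le v)).trans ?_
  have hmin := abs_min_sub_min_le_max u (r / 2 : ℝ) v (r / 2)
  rw [sub_self, abs_zero, max_eq_left (abs_nonneg _)] at hmin
  exact mul_le_mul_of_nonneg_left ((abs_max_sub_max_le_abs _ _ _).trans hmin) hL0

lemma iteratedDeriv_polynomial_eval (P : Polynomial ℝ) (n : ℕ) :
    iteratedDeriv n (fun x => P.eval x) = fun x => (Polynomial.derivative^[n] P).eval x := by
  induction n with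
  | zero => simp
  | succ n ih =>
    rw [iteratedDeriv_succ, ih]
    ext x
    rw [Polynomial.deriv, Function.iterate_succ_apply']

/-- Taylor's formula with integral remainder, based at a point to the right of which `U`
vanishes. -/
lemma integral_iteratedDeriv_mul_truncPow {U : ℝ → ℝ} (n : ℕ) (hn : n ≠ 0)
    (hU : ContDiff ℝ (n + 1 : ℕ) U) (hU0 : ∀ t, 1 ≤ t → U t = 0) (y : ℝ) :
    ∫ t, (-1) ^ (n + 1) * iteratedDeriv (n + 1) U t * truncPow n (t - y) = U y := by
  have hzero : ∀ k, ∀ t, 1 < t → iteratedDeriv k U t = 0 := by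
    intro k t ht
    have : U =ᶠ[nhds t] fun _ => (0 : ℝ) := by
      filter_upwards [lt_mem_nhds ht] with s hs using hU0 s hs.le
    rw [this.iteratedDeriv_eq]
    simp
  set b := max y 1 + 1 with hb
  have hyb : y < b := by linarith [le_max_left y 1]
  have h1b : 1 < b := by linarith [le_max_right y 1]
  have hud : UniqueDiffOn ℝ (Set.uIcc b y) := uniqueDiffOn_uIcc hyb.ne'
  have hwithin : ∀ k ≤ n + 1, ∀ t ∈ Set.uIcc b y,
      iteratedDerivWithin k U (Set.uIcc b y) t = iteratedDeriv k U t := fun k hk t ht =>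
    iteratedDerivWithin_eq_iteratedDeriv hud
      ((hU.of_le (by exact_mod_cast hk)).contDiffAt) ht
  have htaylor := taylor_integral_remainder (f := U) (x := y) (x₀ := b) (n := n) hU.contDiffOn
  have htz : taylorWithinEval U n (Set.uIcc b y) b y = 0 := by
    rw [taylor_within_apply]
    refine Finset.sum_eq_zero fun k hk => ?_
    rw [hwithin k (by have := Finset.mem_range.1 hk; omega) b Set.left_mem_uIcc, hzero k b h1b,
      smul_zero]
  rw [htz, sub_zero] at htaylor
  rw [htaylor, intervalIntegral.integral_symm, ← intervalIntegral.integral_neg,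
    ← intervalIntegral.integral_eq_integral_of_support_subset (a := y) (b := b)]
  · refine intervalIntegral.integral_congr fun t ht => ?_
    rw [hwithin (n + 1) le_rfl t (by rwa [Set.uIcc_comm])]
    rw [Set.uIcc_of_le hyb.le] at ht
    rw [truncPow_of_nonneg (by linarith [ht.1]), smul_eq_mul,
      show y - t = -1 * (t - y) by ring, mul_pow]
    ring
  · intro t ht
    rw [Function.mem_support] at ht
    constructor
    · by_contra h
      exact ht (by rw [truncPow_of_nonpos hn (by linarith), mul_zero])
    · by_contra h
      exact ht (by rw [hzero _ t (by linarith)]; ring)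

/-- The polynomial `∏_{i=1}^{n} (i - x) / n!`. -/
def dualPoly (n : ℕ) : Polynomial ℝ :=
  Polynomial.C (n.factorial : ℝ)⁻¹ *
    ∏ i ∈ Finset.range n, (Polynomial.C ((i : ℝ) + 1) - Polynomial.X)

lemma eval_dualPoly (n : ℕ) (x : ℝ) :
    (dualPoly n).eval x = (n.factorial : ℝ)⁻¹ * ∏ i ∈ Finset.range n, ((i : ℝ) + 1 - x) := by
  simp [dualPoly, Polynomial.eval_prod]

lemma eval_dualPoly_zero (n : ℕ) : (dualPoly n).eval 0 = 1 := by
  rw [eval_dualPoly]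
  have : ∏ i ∈ Finset.range n, ((i : ℝ) + 1 - 0) = n.factorial := by
    rw [← Finset.prod_range_add_one_eq_factorial]; push_cast; simp
  rw [this, inv_mul_cancel₀ (by positivity)]

lemma eval_dualPoly_eq_zero {n j : ℕ} (h1 : 1 ≤ j) (hn : j ≤ n) : (dualPoly n).eval (j : ℝ) = 0 := by
  rw [eval_dualPoly, Finset.prod_eq_zero (i := j - 1), mul_zero]
  · simp; omega
  · rw [Nat.cast_sub h1]; simp

lemma natDegree_dualPoly_le (n : ℕ) : (dualPoly n).natDegree ≤ n := by
  refine (Polynomial.natDegree_C_mul_le _ _).trans ((Polynomial.natDegree_prod_le _ _).trans ?_)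
  refine (Finset.sum_le_sum (g := fun _ => 1) fun i _ => ?_).trans (by simp)
  refine (Polynomial.natDegree_sub_le _ _).trans ?_
  rw [Polynomial.natDegree_C, Polynomial.natDegree_X]
  simp

/-- The function whose `r`-th derivative is, up to sign, dual to the B-spline of order `r`. -/
def dualPrimitive (r : ℕ) (y : ℝ) : ℝ :=
  Real.smoothTransition (1 - y) * (dualPoly (r - 1)).eval (y + r / 2)

lemma contDiff_dualPrimitive (r : ℕ) (n : ℕ) : ContDiff ℝ n (dualPrimitive r) := by
  unfold dualPrimitive
  have h1 : ContDiff ℝ n (fun y : ℝ => Real.smoothTransition (1 - y)) :=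
    (Real.smoothTransition.contDiff (n := n)).comp (contDiff_const.sub contDiff_id)
  have h2 : ContDiff ℝ n (fun y : ℝ => (dualPoly (r - 1)).eval (y + r / 2)) :=
    (show ContDiff ℝ n (fun y : ℝ => (dualPoly (r - 1)).eval y) by
      simpa only [Polynomial.coe_aeval_eq_eval] using
        Polynomial.contDiff_aeval (𝕜 := ℝ) (dualPoly (r - 1)) n).comp
      (contDiff_id.add contDiff_const)
  exact h1.mul h2

lemma dualPrimitive_fwdDiff {r : ℕ} (hr : 2 ≤ r) (k : ℤ) :
    (-1) ^ r * (fwdDiff (1 : ℝ))^[r] (dualPrimitive r) (k - r / 2) = if k = 0 then 1 else 0 := by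
  have hr' : (2 : ℝ) ≤ r := by exact_mod_cast hr
  have hval : ∀ i : ℕ, dualPrimitive r ((k : ℝ) - r / 2 + i) =
      Real.smoothTransition (1 - ((k + i : ℤ) - r / 2)) * (dualPoly (r - 1)).eval ((k + i : ℤ) : ℝ) := by
    intro i
    rw [dualPrimitive]
    push_cast
    congr 2 <;> ring
  have hpos : ∀ i : ℕ, 0 < k + i → dualPrimitive r ((k : ℝ) - r / 2 + i) = 0 := by
    intro i hi
    rw [hval]
    by_cases h : k + i ≤ (r - 1 : ℕ)
    · obtain ⟨j, hj⟩ := Int.eq_ofNat_of_zero_le hi.le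
      rw [hj]
      rw [Int.cast_natCast, eval_dualPoly_eq_zero (by omega) (by omega), mul_zero]
    · have : (r : ℤ) ≤ k + i := by omega
      have : (r : ℝ) ≤ ((k + i : ℤ) : ℝ) := by exact_mod_cast this
      rw [Real.smoothTransition.zero_of_nonpos (by linarith), zero_mul]
  have hneg : ∀ i : ℕ, k + i ≤ 0 → dualPrimitive r ((k : ℝ) - r / 2 + i) =
      (dualPoly (r - 1)).eval ((k + i : ℤ) : ℝ) := by
    intro i hi
    have : ((k + i : ℤ) : ℝ) ≤ 0 := by exact_mod_cast hi
    rw [hval, Real.smoothTransition.one_of_one_le (by linarith), one_mul]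
  rcases lt_trichotomy k 0 with hk | hk | hk
  · rw [if_neg hk.ne]
    have : (fwdDiff (1 : ℝ))^[r] (dualPrimitive r) (k - r / 2) =
        (fwdDiff (1 : ℝ))^[r] (fun x => (dualPoly (r - 1)).eval x) k := by
      rw [fwdDiff_iter_apply, fwdDiff_iter_apply]
      refine Finset.sum_congr rfl fun i hi => ?_
      have hi' := Finset.mem_range.1 hi
      congr 1
      by_cases h : k + i ≤ 0
      · rw [hneg i h]; push_cast; rfl
      · rw [hpos i (by omega)]
        obtain ⟨j, hj⟩ := Int.eq_ofNat_of_zero_le (not_le.1 h).le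
        have : (k : ℝ) + i = j := by exact_mod_cast hj
        rw [this, eval_dualPoly_eq_zero (by omega) (by omega)]
    rw [this, Polynomial.fwdDiff_iter_eq_zero_of_degree_lt
      (lt_of_le_of_lt (natDegree_dualPoly_le _) (by omega))]
    simp
  · subst hk
    rw [if_pos rfl, fwdDiff_iter_apply, Finset.sum_range_succ', Finset.sum_eq_zero, hneg 0 (by simp)]
    · simp [eval_dualPoly_zero, ← mul_pow]
    · intro i _
      rw [hpos (i + 1) (by push_cast; omega), mul_zero]
  · rw [if_neg hk.ne', fwdDiff_iter_apply, Finset.sum_eq_zero, mul_zero]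
    intro i _
    rw [hpos i (by omega), mul_zero]

/-- The integer translates of the B-spline have a continuous dual function supported in
`[0, 1]`. -/
lemma exists_Bspline_dual {r : ℕ} (hr : 2 ≤ r) :
    ∃ w : ℝ → ℝ, Continuous w ∧ (∀ t, t ∉ Set.Icc (0 : ℝ) 1 → w t = 0) ∧
      ∀ k : ℤ, ∫ t, w t * Bspline r (t - k) = if k = 0 then 1 else 0 := by
  obtain ⟨n, rfl⟩ : ∃ n, r = n + 1 := ⟨r - 1, by omega⟩
  have hn : n ≠ 0 := by omega
  set U := dualPrimitive (n + 1) with hU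
  have hU0 : ∀ t, 1 ≤ t → U t = 0 := fun t ht => by
    rw [hU, dualPrimitive, Real.smoothTransition.zero_of_nonpos (by linarith), zero_mul]
  have hsm : ContDiff ℝ (n + 1 : ℕ) U := contDiff_dualPrimitive _ _
  have hcont : Continuous fun t => (-1) ^ (n + 1) * iteratedDeriv (n + 1) U t :=
    continuous_const.mul (hsm.continuous_iteratedDeriv' (n + 1))
  have hsupp : ∀ t, t ∉ Set.Icc (0 : ℝ) 1 → (-1) ^ (n + 1) * iteratedDeriv (n + 1) U t = 0 := by
    intro t ht
    rw [Set.mem_Icc, not_and_or, not_le, not_le] at ht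
    rcases ht with ht | ht
    · have : U =ᶠ[nhds t] fun x => ((dualPoly n).comp
          (Polynomial.X + Polynomial.C (((n + 1 : ℕ) : ℝ) / 2))).eval x := by
        filter_upwards [gt_mem_nhds ht] with s hs
        rw [hU, dualPrimitive, Real.smoothTransition.one_of_one_le (by linarith), one_mul]
        simp
      rw [this.iteratedDeriv_eq, iteratedDeriv_polynomial_eval,
        Polynomial.iterate_derivative_eq_zero]
      · simp
      · rw [Polynomial.natDegree_comp, Polynomial.natDegree_X_add_C, mul_one]
        exact Nat.lt_succ_of_le (natDegree_dualPoly_le n)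
    · have : U =ᶠ[nhds t] fun _ => (0 : ℝ) := by
        filter_upwards [lt_mem_nhds ht] with s hs using hU0 s hs.le
      rw [this.iteratedDeriv_eq]
      simp
  refine ⟨fun t => (-1) ^ (n + 1) * iteratedDeriv (n + 1) U t, hcont, hsupp, fun k => ?_⟩
  rw [← dualPrimitive_fwdDiff hr k, fwdDiff_iter_apply, Finset.mul_sum]
  have hcs : HasCompactSupport fun t => (-1) ^ (n + 1) * iteratedDeriv (n + 1) U t :=
    HasCompactSupport.intro isCompact_Icc hsupp
  have hterm : ∀ t, (-1) ^ (n + 1) * iteratedDeriv (n + 1) U t * Bspline (n + 1) (t - k) =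
      ∑ i ∈ Finset.range (n + 1 + 1), (-1 : ℝ) ^ (n + 1 - i) * (n + 1).choose i *
        ((-1) ^ (n + 1) * iteratedDeriv (n + 1) U t *
          truncPow n (t - (k + ((n + 1 : ℕ) : ℝ) / 2 - i))) := by
    intro t
    rw [Bspline_eq_fwdDiff, fwdDiff_iter_apply, Finset.mul_sum]
    refine Finset.sum_congr rfl fun i _ => ?_
    rw [Nat.add_sub_cancel, show t - k - ((n + 1 : ℕ) : ℝ) / 2 + i =
      t - (k + ((n + 1 : ℕ) : ℝ) / 2 - i) by ring]
    ring
  simp_rw [hterm]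
  rw [integral_finsetSum]
  · simp_rw [integral_const_mul, integral_iteratedDeriv_mul_truncPow n hn hsm hU0]
    rw [← Finset.sum_range_reflect]
    refine Finset.sum_congr rfl fun i hi => ?_
    have hi' : i ≤ n + 1 := Finset.mem_range_succ_iff.1 hi
    rw [show n + 1 + 1 - 1 - i = n + 1 - i by omega, Nat.choose_symm hi', Nat.sub_sub_self hi',
      Nat.cast_sub hi', ← hU, show (k : ℝ) + ((n + 1 : ℕ) : ℝ) / 2 - (((n + 1 : ℕ) : ℝ) - i) =
        k - ((n + 1 : ℕ) : ℝ) / 2 + i by ring, ← mul_assoc, ← mul_assoc, ← pow_add]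
    congr 2
    rw [show n + 1 + (n + 1 - i) = 2 * (n + 1 - i) + i by omega, pow_add, pow_mul]
    simp
  · intro i _
    refine Integrable.const_mul ?_ _
    refine (hcont.mul ((continuous_truncPow n).comp (continuous_id.sub continuous_const)))
      |>.integrable_of_hasCompactSupport hcs.mul_right

/-- The `L_p` norm of a nonnegative extended real function. -/
def lpn {d : ℕ} (p : ℝ) (φ : Euc d → ℝ≥0∞) : ℝ≥0∞ := (∫⁻ x, φ x ^ p) ^ (1 / p)

section lpn

variable {d : ℕ} {p : ℝ}

lemma LpN_eq_lpn (hp : 1 ≤ p) (F : Euc d → ℝ) : LpN p F = lpn p fun x => ‖F x‖ₑ := by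
  have h0 : ENNReal.ofReal p ≠ 0 := by simp; linarith
  rw [LpN, eLpNorm_eq_lintegral_rpow_enorm_toReal h0 ENNReal.ofReal_ne_top,
    ENNReal.toReal_ofReal (by linarith), lpn]

lemma lpn_mono (hp : 1 ≤ p) {φ ψ : Euc d → ℝ≥0∞} (h : ∀ x, φ x ≤ ψ x) : lpn p φ ≤ lpn p ψ := by
  unfold lpn
  gcongr with x
  exact h x

lemma lpn_const_mul (hp : 1 ≤ p) {φ : Euc d → ℝ≥0∞} (c : ℝ≥0∞) (hφ : Measurable φ) :
    lpn p (fun x => c * φ x) = c * lpn p φ := by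
  have hp0 : 0 < p := by linarith
  simp_rw [lpn, ENNReal.mul_rpow_of_nonneg _ _ hp0.le]
  rw [lintegral_const_mul _ (hφ.pow_const p), ENNReal.mul_rpow_of_nonneg _ _ (by positivity),
    ← ENNReal.rpow_mul, mul_one_div_cancel hp0.ne', ENNReal.rpow_one]

lemma lpn_add_le (hp : 1 ≤ p) {φ ψ : Euc d → ℝ≥0∞} (hφ : Measurable φ) (hψ : Measurable ψ) :
    lpn p (fun x => φ x + ψ x) ≤ lpn p φ + lpn p ψ :=
  ENNReal.lintegral_Lp_add_le hφ.aemeasurable hψ.aemeasurable hp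

lemma lpn_sum_le (hp : 1 ≤ p) {ι : Type*} (s : Finset ι) {φ : ι → Euc d → ℝ≥0∞}
    (hφ : ∀ i, Measurable (φ i)) :
    lpn p (fun x => ∑ i ∈ s, φ i x) ≤ ∑ i ∈ s, lpn p (φ i) := by
  classical
  induction s using Finset.induction_on with
  | empty => simp [lpn, show 0 < p by linarith]
  | insert i s hi ih =>
    simp_rw [Finset.sum_insert hi]
    refine (lpn_add_le hp (hφ i) (Finset.measurable_fun_sum s fun j _ => hφ j)).trans ?_
    gcongr

lemma lpn_sum_le_card_mul (hp : 1 ≤ p) {ι : Type*} (s : Finset ι) {φ : ι → Euc d → ℝ≥0∞}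
    (hφ : ∀ i, Measurable (φ i)) {D : ℝ≥0∞} (hD : ∀ i ∈ s, lpn p (φ i) ≤ D) :
    lpn p (fun x => ∑ i ∈ s, φ i x) ≤ s.card * D :=
  (lpn_sum_le hp s hφ).trans ((Finset.sum_le_card_nsmul _ _ _ hD).trans (by simp))

lemma lpn_comp_add (φ : Euc d → ℝ≥0∞) (h : Euc d) : lpn p (fun x => φ (x + h)) = lpn p φ := by
  unfold lpn
  rw [lintegral_add_right_eq_self (fun x => φ x ^ p) h]

lemma rpow_lintegral_le {X : Type*} [MeasurableSpace X] (ν : Measure X) [IsProbabilityMeasure ν]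
    (hp : 1 ≤ p) {φ : X → ℝ≥0∞} (hφ : Measurable φ) :
    (∫⁻ z, φ z ∂ν) ^ p ≤ ∫⁻ z, φ z ^ p ∂ν := by
  have hp0 : 0 < p := by linarith
  have h := eLpNorm'_le_eLpNorm'_of_exponent_le (μ := ν) (f := φ) zero_lt_one hp
    hφ.aestronglyMeasurable
  simp only [eLpNorm', enorm_eq_self, ENNReal.rpow_one, one_div_one] at h
  rwa [one_div, ENNReal.le_rpow_inv_iff hp0] at h

/-- Minkowski's integral inequality for an average. -/
lemma lpn_lintegral_le {X : Type*} [MeasurableSpace X] (ν : Measure X) [IsProbabilityMeasure ν]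
    (hp : 1 ≤ p) {G : Euc d → X → ℝ≥0∞} (hG : Measurable (Function.uncurry G)) {D : ℝ≥0∞}
    (hD : ∀ᵐ z ∂ν, lpn p (fun x => G x z) ≤ D) :
    lpn p (fun x => ∫⁻ z, G x z ∂ν) ≤ D := by
  have hp0 : 0 < p := by linarith
  rw [lpn, one_div, ENNReal.rpow_inv_le_iff hp0]
  calc ∫⁻ x, (∫⁻ z, G x z ∂ν) ^ p ≤ ∫⁻ x, ∫⁻ z, G x z ^ p ∂ν :=
        lintegral_mono fun x => rpow_lintegral_le ν hp (hG.comp measurable_prodMk_left)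
    _ = ∫⁻ z, (∫⁻ x, G x z ^ p) ∂ν := lintegral_lintegral_swap (hG.pow_const p).aemeasurable
    _ ≤ ∫⁻ _, D ^ p ∂ν := by
        refine lintegral_mono_ae ?_
        filter_upwards [hD] with z hz
        rwa [lpn, one_div, ENNReal.rpow_inv_le_iff hp0] at hz
    _ = D ^ p := by simp

end lpn

section smod

variable {d : ℕ} {p : ℝ}

lemma diffOp_one (h : Euc d) (f : Euc d → ℝ) (x : Euc d) : diffOp h 1 f x = f (x + h) - f x := by
  simp [diffOp, Finset.sum_range_succ, sub_eq_add_neg]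

lemma lpn_sub_le_smod (hp : 1 ≤ p) (f : Euc d → ℝ) {δ : ℝ} {h : Euc d} (hh : ‖h‖ < δ) :
    lpn p (fun x => ‖f (x + h) - f x‖ₑ) ≤ smod p 1 f δ := by
  have : lpn p (fun x => ‖f (x + h) - f x‖ₑ) = LpN p (diffOp h 1 f) := by
    rw [LpN_eq_lpn hp]; simp_rw [diffOp_one]
  rw [this]
  exact le_iSup₂_of_le h hh le_rfl

lemma smod_one_le (hp : 1 ≤ p) {f : Euc d → ℝ} {δ : ℝ} {D : ℝ≥0∞}
    (hD : ∀ h : Euc d, ‖h‖ < δ → lpn p (fun x => ‖f (x + h) - f x‖ₑ) ≤ D) : smod p 1 f δ ≤ D := by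
  refine iSup₂_le fun h hh => ?_
  rw [LpN_eq_lpn hp]
  simp_rw [diffOp_one]
  exact hD h hh

lemma smod_mono {r : ℕ} (f : Euc d → ℝ) {δ δ' : ℝ} (h : δ ≤ δ') : smod p r f δ ≤ smod p r f δ' :=
  iSup₂_le fun u hu => le_iSup₂_of_le u (hu.trans_le h) le_rfl

lemma smod_nat_mul_le (hp : 1 ≤ p) {f : Euc d → ℝ} (hf : Measurable f) (n : ℕ) {δ : ℝ} :
    smod p 1 f (n * δ) ≤ n * smod p 1 f δ := by
  refine smod_one_le hp fun h hh => ?_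
  have hn : 0 < n := by
    rcases Nat.eq_zero_or_pos n with rfl | hn
    · simp at hh; linarith [norm_nonneg h]
    · exact hn
  have hn' : (0 : ℝ) < n := by exact_mod_cast hn
  set u : Euc d := (n : ℝ)⁻¹ • h with hu
  have hun : ‖u‖ < δ := by
    rw [hu, norm_smul, norm_inv, Real.norm_natCast, inv_mul_lt_iff₀ hn']
    exact hh
  have hnu : h = (n : ℝ) • u := by rw [hu, smul_smul, mul_inv_cancel₀ hn'.ne', one_smul]
  have hm : ∀ i : ℕ, Measurable fun x : Euc d =>
      ‖f (x + (i : ℝ) • u + u) - f (x + (i : ℝ) • u)‖ₑ := fun i => by fun_prop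
  refine (lpn_mono hp (ψ := fun x => ∑ i ∈ Finset.range n,
    ‖f (x + (i : ℝ) • u + u) - f (x + (i : ℝ) • u)‖ₑ) fun x => ?_).trans
    ((lpn_sum_le_card_mul hp _ hm fun i _ => ?_).trans_eq (by rw [Finset.card_range]))
  · have := Finset.sum_range_sub (fun i : ℕ => f (x + (i : ℝ) • u)) n
    simp only [Nat.cast_zero, zero_smul, add_zero, ← hnu] at this
    rw [← this]
    refine (enorm_sum_le _ _).trans_eq ?_
    refine Finset.sum_congr rfl fun i _ => ?_
    congr 3
    push_cast
    rw [add_smul, one_smul, add_assoc]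
  · rw [lpn_comp_add (fun x => ‖f (x + u) - f x‖ₑ)]
    exact lpn_sub_le_smod hp f hun

lemma lpn_enorm_sub_le (hp : 1 ≤ p) {F G : Euc d → ℝ} (hF : Measurable F) (hG : Measurable G) :
    lpn p (fun x => ‖F x - G x‖ₑ) ≤ lpn p (fun x => ‖F x‖ₑ) + lpn p (fun x => ‖G x‖ₑ) :=
  (lpn_mono hp fun _ => enorm_sub_le).trans (lpn_add_le hp hF.enorm hG.enorm)

lemma smod_one_le_two_mul (hp : 1 ≤ p) {f : Euc d → ℝ} (hf : Measurable f) (δ : ℝ) :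
    smod p 1 f δ ≤ 2 * LpN p f := by
  refine smod_one_le hp fun h _ => ?_
  refine (lpn_enorm_sub_le hp (by fun_prop) hf).trans_eq ?_
  rw [lpn_comp_add (fun x => ‖f x‖ₑ), LpN_eq_lpn hp, two_mul]

end smod

section spline

variable {d : ℕ}

@[simp]
lemma gridPt_apply (σ : ℝ) (k : Fin d → ℤ) (i : Fin d) : gridPt σ k i = k i / σ := by
  simp [gridPt]

lemma abs_prod_sub_prod_le {ι : Type*} (s : Finset ι) {a b : ι → ℝ} {C D : ℝ} (hC : 1 ≤ C)
    (ha : ∀ i, |a i| ≤ C) (hb : ∀ i, |b i| ≤ C) (hab : ∀ i, |a i - b i| ≤ D) :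
    |∏ i ∈ s, a i - ∏ i ∈ s, b i| ≤ s.card * C ^ s.card * D := by
  classical
  induction s using Finset.induction_on with
  | empty => simp
  | insert i s hi ih =>
    have hD : 0 ≤ D := (abs_nonneg _).trans (hab i)
    have hC0 : 0 ≤ C := by linarith
    have hprod : |∏ j ∈ s, a j| ≤ C ^ s.card := by
      rw [Finset.abs_prod]
      exact (Finset.prod_le_prod (fun _ _ => abs_nonneg _) fun j _ => ha j).trans (by simp)
    rw [Finset.prod_insert hi, Finset.prod_insert hi, Finset.card_insert_of_notMem hi,
      show a i * ∏ j ∈ s, a j - b i * ∏ j ∈ s, b j =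
        (a i - b i) * ∏ j ∈ s, a j + b i * (∏ j ∈ s, a j - ∏ j ∈ s, b j) by ring]
    refine (abs_add_le _ _).trans ?_
    rw [abs_mul, abs_mul]
    calc |a i - b i| * |∏ j ∈ s, a j| + |b i| * |∏ j ∈ s, a j - ∏ j ∈ s, b j|
        ≤ D * C ^ s.card + C * (s.card * C ^ s.card * D) :=
          add_le_add (mul_le_mul (hab i) hprod (abs_nonneg _) hD)
            (mul_le_mul (hb i) ih (abs_nonneg _) hC0)
      _ ≤ D * C ^ (s.card + 1) + C * (s.card * C ^ s.card * D) := by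
          gcongr
          · omega
      _ = ((s.card + 1 : ℕ) : ℝ) * C ^ (s.card + 1) * D := by push_cast; ring

lemma exists_Bspline_bound {r : ℕ} (hr : 2 ≤ r) : ∃ C : ℝ, 1 ≤ C ∧ ∀ u, |Bspline r u| ≤ C := by
  obtain ⟨L, hL, h⟩ := exists_Bspline_lipschitz hr
  refine ⟨1 + L * r, by linarith [mul_nonneg hL (Nat.cast_nonneg (α := ℝ) r)], fun u => ?_⟩
  have hLr : 0 ≤ L * r := by positivity
  by_cases hu : (r : ℝ) / 2 ≤ |u|
  · rw [Bspline_eq_zero hr hu, abs_zero]; linarith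
  · have h1 := h u (r / 2)
    rw [Bspline_eq_zero hr (le_abs_self _), sub_zero] at h1
    have h2 : |u - r / 2| ≤ r := by
      rw [not_le, abs_lt] at hu
      rw [abs_le]; constructor <;> linarith
    have := mul_le_mul_of_nonneg_left h2 hL
    linarith

lemma exists_BsplineKer_bound (d : ℕ) {r : ℕ} (hr : 2 ≤ r) : ∃ K : NNReal,
    (∀ x : Euc d, ‖BsplineKer r x‖ₑ ≤ K) ∧
    ∀ x y : Euc d, ‖BsplineKer r x - BsplineKer r y‖ₑ ≤ K * ‖x - y‖ₑ := by
  obtain ⟨L, hL, hLip⟩ := exists_Bspline_lipschitz hr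
  obtain ⟨C, hC, hbd⟩ := exists_Bspline_bound hr
  have hC0 : 0 ≤ C := by linarith
  have key : ∀ (x : Euc d) (K : ℝ), C ^ d ≤ K → ‖BsplineKer r x‖ ≤ K := by
    intro x K hK
    refine le_trans ?_ hK
    rw [BsplineKer, Real.norm_eq_abs, Finset.abs_prod]
    exact (Finset.prod_le_prod (fun _ _ => abs_nonneg _) fun j _ => hbd _).trans (by simp)
  obtain ⟨K, hK⟩ : ∃ K : NNReal, (K : ℝ) = C ^ d + d * C ^ d * L :=
    CanLift.prf (C ^ d + d * C ^ d * L) (by positivity)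
  refine ⟨K, fun x => ?_, fun x y => ?_⟩
  · rw [enorm_eq_nnnorm, ENNReal.coe_le_coe, ← NNReal.coe_le_coe, coe_nnnorm, hK]
    exact key x _ (le_add_of_nonneg_right (by positivity))
  · rw [enorm_eq_nnnorm, enorm_eq_nnnorm, ← ENNReal.coe_mul, ENNReal.coe_le_coe,
      ← NNReal.coe_le_coe, NNReal.coe_mul, coe_nnnorm, coe_nnnorm, hK]
    have h := abs_prod_sub_prod_le (Finset.univ : Finset (Fin d)) (D := L * ‖x - y‖) hC
      (fun i => hbd (x i)) (fun i => hbd (y i)) fun i => (hLip _ _).trans (by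
        gcongr
        simpa using PiLp.norm_apply_le (x - y) i)
    rw [Finset.card_univ, Fintype.card_fin] at h
    refine h.trans ?_
    rw [← mul_assoc, add_mul]
    exact le_add_of_nonneg_left (by positivity)

/-- The index of the grid cell containing a point. -/
def cellIdx (σ : ℝ) (x : Euc d) : Fin d → ℤ := fun i => ⌊σ * x i⌋

/-- The spline with given coefficients on the grid of step `σ⁻¹`. -/
def spl (r : ℕ) (σ : ℝ) (a : (Fin d → ℤ) → ℝ) (x : Euc d) : ℝ :=
  ∑' k : Fin d → ℤ, a k * BsplineKer r (σ • x - gridPt 1 k)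

/-- The shifts that contribute to the value of a spline at a point. -/
def splBox (d r : ℕ) : Finset (Fin d → ℤ) :=
  Fintype.piFinset fun _ => Finset.Icc (-(2 * r : ℕ) : ℤ) (2 * r : ℕ)

lemma measurable_cellIdx (σ : ℝ) : Measurable (cellIdx (d := d) σ) :=
  measurable_pi_lambda _ fun _ => Int.measurable_floor.comp (by fun_prop)

lemma measurable_comp_cellIdx {Y : Type*} [MeasurableSpace Y] (σ : ℝ) (a : (Fin d → ℤ) → Y) :
    Measurable fun x : Euc d => a (cellIdx σ x) :=
  (measurable_of_countable a).comp (measurable_cellIdx σ)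

lemma cellIdx_add_gridPt {σ : ℝ} (hσ : 0 < σ) (x : Euc d) (m : Fin d → ℤ) :
    cellIdx σ (x + gridPt σ m) = cellIdx σ x + m := by
  funext i
  simp only [cellIdx, PiLp.add_apply, gridPt_apply, Pi.add_apply, mul_add]
  rw [mul_div_cancel₀ _ hσ.ne', Int.floor_add_intCast]

lemma cellIdx_mem (σ : ℝ) (x : Euc d) (i : Fin d) :
    σ * x i - cellIdx σ x i ∈ Set.Ico (0 : ℝ) 1 :=
  ⟨Int.fract_nonneg _, Int.fract_lt_one _⟩

lemma BsplineKer_apply (r : ℕ) (σ : ℝ) (x : Euc d) (k : Fin d → ℤ) :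
    BsplineKer r (σ • x - gridPt 1 k) = ∏ i, Bspline r (σ * x i - k i) := by
  simp [BsplineKer]

variable {r : ℕ} {σ : ℝ} {x : Euc d} {k : Fin d → ℤ}

lemma spl_eq_sum (hr : 2 ≤ r) (hk : ∀ i, σ * x i - k i ∈ Set.Icc (-1 : ℝ) 2)
    (a : (Fin d → ℤ) → ℝ) :
    spl r σ a x = ∑ m ∈ splBox d r, a (k + m) * BsplineKer r (σ • x - gridPt 1 (k + m)) := by
  rw [spl, ← (Equiv.addLeft k).tsum_eq, tsum_eq_sum (s := splBox d r)]
  · rfl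
  · intro m hm
    have : ∃ i, m i ∉ Finset.Icc (-(2 * r : ℕ) : ℤ) (2 * r : ℕ) := by
      simpa [splBox, Fintype.mem_piFinset, -Finset.mem_Icc] using hm
    obtain ⟨i, hi⟩ := this
    rw [Equiv.coe_addLeft, BsplineKer_apply, Finset.prod_eq_zero (Finset.mem_univ i), mul_zero]
    apply Bspline_eq_zero hr
    obtain ⟨h1, h2⟩ := hk i
    have hr' : (2 : ℝ) ≤ r := by exact_mod_cast hr
    simp only [Pi.add_apply]
    push_cast
    rw [Finset.mem_Icc, not_and_or, not_le, not_le] at hi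
    rcases hi with hi | hi
    · have : (m i : ℝ) + 1 ≤ -(2 * r) := by exact_mod_cast hi
      refine le_trans ?_ (le_abs_self _)
      linarith
    · have : (2 * r : ℝ) + 1 ≤ m i := by exact_mod_cast hi
      refine le_trans ?_ (neg_le_abs _)
      linarith

lemma sum_BsplineKer (hr : 2 ≤ r) (hk : ∀ i, σ * x i - k i ∈ Set.Icc (-1 : ℝ) 2) :
    ∑ m ∈ splBox d r, BsplineKer r (σ • x - gridPt 1 (k + m)) = 1 := by
  simp_rw [BsplineKer_apply, splBox]
  have := Finset.prod_univ_sum (fun _ : Fin d => Finset.Icc (-(2 * r : ℕ) : ℤ) (2 * r : ℕ))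
    fun i j => Bspline r (σ * x i - k i - j)
  rw [Finset.prod_congr rfl fun i _ => sum_Bspline_shift hr le_rfl (hk i), Finset.prod_const_one]
    at this
  rw [this]
  refine Finset.sum_congr rfl fun m _ => Finset.prod_congr rfl fun i _ => ?_
  rw [Pi.add_apply]
  push_cast
  rw [sub_sub]

lemma cellIdx_mem_Icc (σ : ℝ) (x : Euc d) (i : Fin d) :
    σ * x i - cellIdx σ x i ∈ Set.Icc (-1 : ℝ) 2 := by
  obtain ⟨h1, h2⟩ := cellIdx_mem σ x i
  constructor <;> linarith

lemma enorm_sub_spl_le (hr : 2 ≤ r) {K : NNReal} (hK : ∀ x : Euc d, ‖BsplineKer r x‖ₑ ≤ K)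
    (σ : ℝ) (a : (Fin d → ℤ) → ℝ) (x : Euc d) (c : ℝ) :
    ‖c - spl r σ a x‖ₑ ≤ K * ∑ m ∈ splBox d r, ‖c - a (cellIdx σ x + m)‖ₑ := by
  have : c - spl r σ a x = ∑ m ∈ splBox d r,
      (c - a (cellIdx σ x + m)) * BsplineKer r (σ • x - gridPt 1 (cellIdx σ x + m)) := by
    simp_rw [sub_mul]
    rw [Finset.sum_sub_distrib, ← Finset.mul_sum, sum_BsplineKer hr (cellIdx_mem_Icc σ x), mul_one,
      spl_eq_sum hr (cellIdx_mem_Icc σ x)]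
  rw [this, Finset.mul_sum]
  refine (enorm_sum_le _ _).trans (Finset.sum_le_sum fun m _ => ?_)
  rw [enorm_mul, mul_comm]
  gcongr
  exact hK _

lemma enorm_spl_add_sub_le (hr : 2 ≤ r) {K : NNReal}
    (hK : ∀ x y : Euc d, ‖BsplineKer r x - BsplineKer r y‖ₑ ≤ K * ‖x - y‖ₑ)
    (a : (Fin d → ℤ) → ℝ) (x : Euc d) {h : Euc d} (hh : ‖σ • h‖ ≤ 1) :
    ‖spl r σ a (x + h) - spl r σ a x‖ₑ ≤ K * ‖σ • h‖ₑ *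
      ∑ m ∈ splBox d r, ‖a (cellIdx σ x + m) - a (cellIdx σ x)‖ₑ := by
  have hk : ∀ i, σ * (x + h) i - cellIdx σ x i ∈ Set.Icc (-1 : ℝ) 2 := by
    intro i
    obtain ⟨h1, h2⟩ := cellIdx_mem σ x i
    have h3 := (PiLp.norm_apply_le (σ • h) i).trans hh
    rw [Real.norm_eq_abs, abs_le] at h3
    simp only [PiLp.smul_apply, smul_eq_mul] at h3
    rw [PiLp.add_apply, mul_add]
    constructor <;> linarith [h3.1, h3.2]
  set k := cellIdx σ x with hkdef
  have : spl r σ a (x + h) - spl r σ a x = ∑ m ∈ splBox d r, (a (k + m) - a k) *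
      (BsplineKer r (σ • (x + h) - gridPt 1 (k + m)) - BsplineKer r (σ • x - gridPt 1 (k + m))) := by
    simp_rw [sub_mul, mul_sub]
    rw [Finset.sum_sub_distrib, Finset.sum_sub_distrib, Finset.sum_sub_distrib, ← Finset.mul_sum,
      ← Finset.mul_sum, sum_BsplineKer hr (cellIdx_mem_Icc σ x), sum_BsplineKer hr hk, sub_self,
      sub_zero, spl_eq_sum hr (cellIdx_mem_Icc σ x), spl_eq_sum hr hk]
  rw [this, Finset.mul_sum]
  refine (enorm_sum_le _ _).trans (Finset.sum_le_sum fun m _ => ?_)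
  rw [enorm_mul, mul_comm]
  gcongr
  refine (hK _ _).trans_eq ?_
  congr 2
  rw [smul_add]
  abel

lemma measurable_spl (hr : 2 ≤ r) (σ : ℝ) (a : (Fin d → ℤ) → ℝ) : Measurable (spl r σ a) := by
  have hB : Continuous (BsplineKer (d := d) r) :=
    continuous_finsetProd _ fun i _ => (continuous_Bspline r).comp (by fun_prop)
  have : spl r σ a = fun x => ∑ m ∈ splBox d r, a (cellIdx σ x + m) *
      BsplineKer r (σ • x - gridPt 1 (cellIdx σ x + m)) :=
    funext fun x => spl_eq_sum hr (cellIdx_mem_Icc σ x) a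
  rw [this]
  refine Finset.measurable_fun_sum _ fun m _ => ?_
  refine (measurable_comp_cellIdx σ fun k => a (k + m)).mul (hB.measurable.comp ?_)
  exact (measurable_id.const_smul σ).sub (measurable_comp_cellIdx σ fun k => gridPt 1 (k + m))

/-- The discrete norm of coefficients on the grid of step `σ⁻¹`. -/
def gridNorm (p σ : ℝ) (a : (Fin d → ℤ) → ℝ) : ℝ≥0∞ := lpn p fun x : Euc d => ‖a (cellIdx σ x)‖ₑ

lemma lpn_cellIdx_add {p : ℝ} (hσ : 0 < σ) (φ : (Fin d → ℤ) → ℝ≥0∞) (m : Fin d → ℤ) :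
    lpn p (fun x : Euc d => φ (cellIdx σ x + m)) = lpn p fun x : Euc d => φ (cellIdx σ x) := by
  simp_rw [← cellIdx_add_gridPt hσ]
  exact lpn_comp_add (fun x => φ (cellIdx σ x)) _

lemma spl_add_gridPt (r : ℕ) (hσ : 0 < σ) (a : (Fin d → ℤ) → ℝ) (x : Euc d) (m : Fin d → ℤ) :
    spl r σ a (x + gridPt σ m) = spl r σ (fun k => a (k + m)) x := by
  rw [spl, spl, ← (Equiv.addRight m).tsum_eq]
  refine tsum_congr fun k => ?_
  rw [Equiv.coe_addRight, BsplineKer_apply, BsplineKer_apply]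
  congr 1
  refine Finset.prod_congr rfl fun i _ => ?_
  simp only [PiLp.add_apply, gridPt_apply, mul_add, mul_div_cancel₀ _ hσ.ne', Pi.add_apply]
  push_cast
  ring_nf

lemma spl_sub (hr : 2 ≤ r) (σ : ℝ) (a b : (Fin d → ℤ) → ℝ) (x : Euc d) :
    spl r σ (fun k => a k - b k) x = spl r σ a x - spl r σ b x := by
  simp_rw [spl_eq_sum hr (cellIdx_mem_Icc σ x), sub_mul]
  rw [Finset.sum_sub_distrib]

end spline

section stability

variable {d : ℕ}

lemma lpn_le_mul_of_le_lintegral {p : ℝ} {X : Type*} [MeasurableSpace X] (ν : Measure X)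
    [IsProbabilityMeasure ν] (hp : 1 ≤ p) {φ : Euc d → ℝ≥0∞} {G : Euc d → X → ℝ≥0∞} {c D : ℝ≥0∞}
    (hφ : ∀ x, φ x ≤ c * ∫⁻ z, G x z ∂ν) (hG : Measurable (Function.uncurry G))
    (hD : ∀ᵐ z ∂ν, lpn p (fun x => G x z) ≤ D) : lpn p φ ≤ c * D := by
  have hGm : Measurable fun x => ∫⁻ z, G x z ∂ν := hG.lintegral_prod_right'
  refine (lpn_mono hp hφ).trans ?_
  rw [lpn_const_mul hp c hGm]
  gcongr
  exact lpn_lintegral_le ν hp hG hD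

lemma exists_coeff_le (d : ℕ) {r : ℕ} (hr : 2 ≤ r) :
    ∃ C : NNReal, ∀ (a : (Fin d → ℤ) → ℝ) (k : Fin d → ℤ),
      ‖a k‖ₑ ≤ C * ∫⁻ u in {u : Euc d | ∀ i, u i ∈ Set.Icc (0 : ℝ) 1},
        ‖spl r 1 a (u + gridPt 1 k)‖ₑ := by
  obtain ⟨w, hwc, hw0, hw⟩ := exists_Bspline_dual hr
  have hwcs : HasCompactSupport w := HasCompactSupport.intro isCompact_Icc hw0
  obtain ⟨D, hD⟩ := hwcs.exists_bound_of_continuous hwc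
  have hD0 : 0 ≤ D := (norm_nonneg _).trans (hD 0)
  obtain ⟨C, hC⟩ : ∃ C : NNReal, (C : ℝ) = D ^ d := CanLift.prf (D ^ d) (by positivity)
  refine ⟨C, fun a k => ?_⟩
  set S := {u : Euc d | ∀ i, u i ∈ Set.Icc (0 : ℝ) 1} with hS
  have hSm : MeasurableSet S := by
    have : S = ⋂ i, (fun u : Euc d => u i) ⁻¹' Set.Icc 0 1 := by ext; simp [hS]
    rw [this]
    exact MeasurableSet.iInter fun i => measurableSet_Icc.preimage (by fun_prop)
  have hint : ∀ m : Fin d → ℤ, Integrable fun u : Fin d → ℝ =>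
      ∏ i, (w (u i) * Bspline r (u i - m i)) := by
    intro m
    refine Integrable.fintype_prod (f := fun i t => w t * Bspline r (t - m i)) fun i => ?_
    have hc : Continuous fun t : ℝ => w t * Bspline r (t - m i) :=
      hwc.mul ((continuous_Bspline r).comp (by fun_prop))
    exact hc.integrable_of_hasCompactSupport hwcs.mul_right
  have hfun : ∀ u : Fin d → ℝ,
      (∏ i, w (u i)) * spl r 1 a (WithLp.toLp 2 u + gridPt 1 k) =
      ∑ m ∈ splBox d r, a (k + m) * ∏ i, (w (u i) * Bspline r (u i - m i)) := by
    intro u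
    by_cases hu : ∀ i, u i ∈ Set.Icc (0 : ℝ) 1
    · rw [spl_eq_sum (k := k) hr, Finset.mul_sum]
      · refine Finset.sum_congr rfl fun m _ => ?_
        rw [BsplineKer_apply, Finset.prod_mul_distrib]
        have : ∏ i, Bspline r (1 * (WithLp.toLp 2 u + gridPt 1 k) i - ((k + m) i : ℤ)) =
            ∏ i, Bspline r (u i - m i) := Finset.prod_congr rfl fun i _ => by
          simp only [PiLp.add_apply, gridPt_apply, Pi.add_apply]
          push_cast
          ring_nf
        rw [this]
        ring
      · intro i
        have := hu i
        simp only [PiLp.add_apply, gridPt_apply, div_one, one_mul, add_sub_cancel_right]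
        constructor <;> linarith [this.1, this.2]
    · push Not at hu
      obtain ⟨i, hi⟩ := hu
      rw [Finset.prod_eq_zero (Finset.mem_univ i) (hw0 _ hi), zero_mul]
      refine (Finset.sum_eq_zero fun m _ => ?_).symm
      rw [Finset.prod_eq_zero (Finset.mem_univ i) (by rw [hw0 _ hi, zero_mul]), mul_zero]
  have hak : a k = ∫ u : Fin d → ℝ,
      (∏ i, w (u i)) * spl r 1 a (WithLp.toLp 2 u + gridPt 1 k) := by
    simp_rw [hfun]
    rw [integral_finsetSum _ fun m _ => (hint m).const_mul _]
    have : ∀ m : Fin d → ℤ, ∫ u : Fin d → ℝ, a (k + m) * ∏ i, (w (u i) * Bspline r (u i - m i)) =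
        if m = 0 then a k else 0 := by
      intro m
      rw [integral_const_mul,
        integral_fintype_prod_volume_eq_prod (fun i t => w t * Bspline r (t - m i))]
      simp_rw [hw]
      by_cases hm : m = 0
      · simp [hm]
      · obtain ⟨i, hi⟩ := Function.ne_iff.mp hm
        rw [if_neg hm, Finset.prod_eq_zero (Finset.mem_univ i) (if_neg hi), mul_zero]
    simp_rw [this]
    rw [Finset.sum_ite_eq' , if_pos]
    simp [splBox, Fintype.mem_piFinset]
  have htr := (PiLp.volume_preserving_toLp (Fin d)).lintegral_comp_emb
    (MeasurableEquiv.toLp 2 (Fin d → ℝ)).measurableEmbedding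
    fun x : Euc d => ‖(∏ i, w (x i)) * spl r 1 a (x + gridPt 1 k)‖ₑ
  calc ‖a k‖ₑ ≤ ∫⁻ u : Fin d → ℝ,
        ‖(∏ i, w (u i)) * spl r 1 a (WithLp.toLp 2 u + gridPt 1 k)‖ₑ := by
        rw [hak]; exact enorm_integral_le_lintegral_enorm _
    _ = ∫⁻ x : Euc d, ‖(∏ i, w (x i)) * spl r 1 a (x + gridPt 1 k)‖ₑ := htr
    _ ≤ ∫⁻ x : Euc d, S.indicator (fun x => C * ‖spl r 1 a (x + gridPt 1 k)‖ₑ) x := by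
        refine lintegral_mono fun x => ?_
        by_cases hx : x ∈ S
        · simp only [Set.indicator_of_mem hx, enorm_mul]
          gcongr
          rw [enorm_eq_nnnorm, ENNReal.coe_le_coe, ← NNReal.coe_le_coe, coe_nnnorm, hC, norm_prod]
          exact (Finset.prod_le_prod (fun _ _ => norm_nonneg _) fun i _ => hD _).trans (by simp)
        · simp only [hS, Set.mem_ofPred_eq] at hx
          push Not at hx
          obtain ⟨i, hi⟩ := hx
          rw [Finset.prod_eq_zero (Finset.mem_univ i) (hw0 _ hi)]
          simp
    _ = ∫⁻ x in S, C * ‖spl r 1 a (x + gridPt 1 k)‖ₑ := lintegral_indicator hSm _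
    _ = C * ∫⁻ u in S, ‖spl r 1 a (u + gridPt 1 k)‖ₑ := lintegral_const_mul' _ _ ENNReal.coe_ne_top

/-- The uniform probability measure on the centred ball of a given radius. -/
def unifBall (d : ℕ) (R : ℝ) : Measure (Euc d) :=
  (volume (ball (0 : Euc d) R))⁻¹ • volume.restrict (ball (0 : Euc d) R)

lemma volume_ball_ne_zero {R : ℝ} (hR : 0 < R) (x : Euc d) : volume (ball x R) ≠ 0 :=
  (measure_ball_pos volume x hR).ne'

lemma isProbabilityMeasure_unifBall {R : ℝ} (hR : 0 < R) :
    IsProbabilityMeasure (unifBall d R) :=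
  ⟨by simp [unifBall, ENNReal.inv_mul_cancel (volume_ball_ne_zero hR _) measure_ball_lt_top.ne]⟩

lemma ae_unifBall_norm_lt (R : ℝ) : ∀ᵐ z ∂unifBall d R, ‖z‖ < R := by
  refine Measure.ae_smul_measure ?_ _
  filter_upwards [ae_restrict_mem measurableSet_ball] with z hz
  simpa using hz

lemma setLIntegral_ball_eq {R : ℝ} (hR : 0 < R) (φ : Euc d → ℝ≥0∞) :
    ∫⁻ z in ball 0 R, φ z = volume (ball (0 : Euc d) R) * ∫⁻ z, φ z ∂unifBall d R := by
  rw [unifBall, lintegral_smul_measure, smul_eq_mul, ← mul_assoc,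
    ENNReal.mul_inv_cancel (volume_ball_ne_zero hR _) measure_ball_lt_top.ne, one_mul]

lemma norm_le_of_apply_le (z : Euc d) (hz : ∀ i, |z i| ≤ 1) : ‖z‖ ≤ d := by
  rw [EuclideanSpace.norm_eq, Real.sqrt_le_left (by positivity)]
  calc ∑ i, ‖z i‖ ^ 2 ≤ ∑ _i : Fin d, (1 : ℝ) := by
        refine Finset.sum_le_sum fun i _ => ?_
        rw [Real.norm_eq_abs]
        exact pow_le_one₀ (abs_nonneg _) (hz i)
    _ = d := by simp
    _ ≤ (d : ℝ) ^ 2 := by exact_mod_cast Nat.le_self_pow two_ne_zero d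

lemma spl_smul (r : ℕ) (σ : ℝ) (a : (Fin d → ℤ) → ℝ) (x : Euc d) :
    spl r 1 a (σ • x) = spl r σ a x := by
  simp [spl]

/-- The discrete norm of the coefficients is controlled by the norm of the spline. -/
lemma exists_gridNorm_le (d : ℕ) {r : ℕ} (hr : 2 ≤ r) {p : ℝ} (hp : 1 ≤ p) :
    ∃ C : NNReal, ∀ (σ : ℝ), 0 < σ → ∀ a : (Fin d → ℤ) → ℝ,
      gridNorm p σ a ≤ C * lpn p fun x => ‖spl r σ a x‖ₑ := by
  obtain ⟨C, hC⟩ := exists_coeff_le d hr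
  have hR : (0 : ℝ) < d + 1 := by positivity
  have := isProbabilityMeasure_unifBall (d := d) hR
  set V : NNReal := (volume (ball (0 : Euc d) (d + 1))).toNNReal with hV
  have hV' : (V : ℝ≥0∞) = volume (ball (0 : Euc d) (d + 1)) :=
    ENNReal.coe_toNNReal measure_ball_lt_top.ne
  refine ⟨C * V, fun σ hσ a => ?_⟩
  have hm := measurable_spl (d := d) hr σ a
  have hG : Measurable (Function.uncurry fun x z : Euc d => ‖spl r σ a (x + σ⁻¹ • z)‖ₑ) := by
    unfold Function.uncurry
    exact (hm.comp (by fun_prop)).enorm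
  have hpt : ∀ x : Euc d, ‖a (cellIdx σ x)‖ₑ ≤
      (C * V : NNReal) * ∫⁻ z, ‖spl r σ a (x + σ⁻¹ • z)‖ₑ ∂unifBall d (d + 1) := by
    intro x
    set k := cellIdx σ x
    set v : Euc d := gridPt 1 k - σ • x with hv
    refine (hC a k).trans ?_
    rw [ENNReal.coe_mul, mul_assoc, hV', ← setLIntegral_ball_eq hR]
    refine mul_le_mul_right ?_ _
    rw [← lintegral_indicator measurableSet_ball,
      ← lintegral_add_right_eq_self (μ := volume) (Set.indicator _ _) v]
    refine (setLIntegral_mono_ae' (g := fun u => (ball (0 : Euc d) (d + 1)).indicator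
      (fun z => ‖spl r σ a (x + σ⁻¹ • z)‖ₑ) (u + v)) ?_ ?_).trans (setLIntegral_le_lintegral _ _)
    · have : {u : Euc d | ∀ i, u i ∈ Set.Icc (0 : ℝ) 1} =
          ⋂ i, (fun u : Euc d => u i) ⁻¹' Set.Icc 0 1 := by ext; simp
      rw [this]
      exact MeasurableSet.iInter fun i => measurableSet_Icc.preimage (by fun_prop)
    · refine Eventually.of_forall fun u hu => ?_
      rw [Set.indicator_of_mem]
      · rw [← spl_smul r σ]
        refine le_of_eq ?_
        congr 2
        rw [smul_add, smul_smul, mul_inv_cancel₀ hσ.ne', one_smul, hv]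
        abel
      · rw [mem_ball_zero_iff]
        refine (norm_le_of_apply_le _ fun i => ?_).trans_lt (lt_add_one _)
        obtain ⟨h1, h2⟩ := cellIdx_mem σ x i
        obtain ⟨h3, h4⟩ := hu i
        simp only [hv, PiLp.add_apply, PiLp.sub_apply, gridPt_apply, PiLp.smul_apply, smul_eq_mul,
          div_one]
        rw [abs_le]
        constructor <;> linarith
  refine lpn_le_mul_of_le_lintegral _ hp hpt hG (Eventually.of_forall fun z => ?_)
  exact (lpn_comp_add (fun x => ‖spl r σ a x‖ₑ) _).le

end stability

section averages

variable {d : ℕ}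

lemma sum_avgOp_coeff {r : ℕ} (hr : 1 ≤ r) :
    -(2 / ((2 * r).choose r : ℝ)) *
      ∑ j ∈ Finset.Icc 1 r, (-1 : ℝ) ^ j * ((2 * r).choose (r - j) : ℝ) = 1 := by
  have hpos : (0 : ℝ) < (2 * r).choose r := by exact_mod_cast Nat.choose_pos (by omega)
  set T := ∑ j ∈ Finset.Icc 1 r, (-1 : ℝ) ^ j * ((2 * r).choose (r - j) : ℝ) with hT
  have hTr : T = ∑ i ∈ Finset.range r, (-1 : ℝ) ^ (i + 1) * ((2 * r).choose (r - (i + 1)) : ℝ) := by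
    rw [hT, ← Finset.Ico_add_one_right_eq_Icc, Finset.sum_Ico_eq_sum_range]
    simp [add_comm 1]
  have halt : ∑ i ∈ Finset.range (r + (r + 1)), (-1 : ℝ) ^ i * ((2 * r).choose i : ℝ) = 0 := by
    have := Int.alternating_sum_range_choose_of_ne (n := 2 * r) (by omega)
    rw [show r + (r + 1) = 2 * r + 1 by ring]
    exact_mod_cast this
  have hlow : ∑ i ∈ Finset.range r, (-1 : ℝ) ^ i * ((2 * r).choose i : ℝ) = (-1) ^ r * T := by
    rw [hTr, ← Finset.sum_range_reflect, Finset.mul_sum]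
    refine Finset.sum_congr rfl fun i hi => ?_
    rw [Finset.mem_range] at hi
    have e1 : r - 1 - i = r - (i + 1) := by omega
    rw [e1, ← mul_assoc, ← pow_add]
    congr 1
    rw [show r + (i + 1) = (r - (i + 1)) + 2 * (i + 1) by omega, pow_add, pow_mul]
    simp
  have hhigh : ∑ i ∈ Finset.range r, (-1 : ℝ) ^ (r + (i + 1)) * ((2 * r).choose (r + (i + 1)) : ℝ) =
      (-1) ^ r * T := by
    rw [hTr, Finset.mul_sum]
    refine Finset.sum_congr rfl fun i hi => ?_
    rw [Finset.mem_range] at hi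
    rw [pow_add, mul_assoc, ← Nat.choose_symm (n := 2 * r) (k := r - (i + 1)) (by omega)]
    congr 4
    omega
  rw [Finset.sum_range_add, Finset.sum_range_succ', hlow, hhigh] at halt
  simp only [add_zero] at halt
  have hs : ((-1 : ℝ) ^ r) ≠ 0 := by simp
  have h0 : (-1 : ℝ) ^ r * (2 * T + (2 * r).choose r) = 0 := by linear_combination halt
  have h1 : 2 * T = -((2 * r).choose r : ℝ) := by
    have := (mul_eq_zero.mp h0).resolve_left hs
    linarith
  field_simp
  linarith

lemma volume_ball_ratio {ρ R : ℝ} (hρ : 0 < ρ) (hR : 0 < R) (ξ : Euc d) :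
    (volume (ball ξ ρ))⁻¹ * volume (ball (0 : Euc d) R) = ENNReal.ofReal ((R / ρ) ^ d) := by
  rw [Measure.addHaar_ball_of_pos volume ξ hρ, Measure.addHaar_ball_of_pos volume 0 hR,
    finrank_euclideanSpace_fin]
  have h1 : volume (ball (0 : Euc d) 1) ≠ 0 := volume_ball_ne_zero one_pos 0
  have h2 : volume (ball (0 : Euc d) 1) ≠ ∞ := measure_ball_lt_top.ne
  have h3 : 0 < ρ ^ d := pow_pos hρ d
  rw [ENNReal.mul_inv (Or.inr h2) (Or.inr h1), mul_mul_mul_comm, ENNReal.inv_mul_cancel h1 h2,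
    mul_one, mul_comm, ← ENNReal.ofReal_inv_of_pos h3, ← ENNReal.ofReal_mul (by positivity),
    div_pow, div_eq_mul_inv]

lemma enorm_ballAvg_sub_le {g : Euc d → ℝ} (hg : LocallyIntegrable g) {ρ R : ℝ} (hρ : 0 < ρ)
    {ξ x : Euc d} (hR : dist ξ x + ρ ≤ R) (c : ℝ) :
    ‖ballAvg g ρ ξ - c‖ₑ ≤
      ENNReal.ofReal ((R / ρ) ^ d) * ∫⁻ z, ‖g (x + z) - c‖ₑ ∂unifBall d R := by
  have hR0 : 0 < R := by linarith [dist_nonneg (x := ξ) (y := x)]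
  set μ := volume.restrict (ball ξ ρ) with hμ
  have hμu : μ Set.univ = volume (ball ξ ρ) := by simp [hμ]
  have hfin : IsFiniteMeasure μ := ⟨by rw [hμu]; exact measure_ball_lt_top⟩
  have hne : NeZero μ := ⟨by
    intro h
    rw [h] at hμu
    exact volume_ball_ne_zero hρ ξ (by simpa using hμu.symm)⟩
  have hint : Integrable g μ :=
    (hg.integrableOn_isCompact (isCompact_closedBall ξ ρ)).mono_set ball_subset_closedBall
  have hint' : Integrable g ((μ Set.univ)⁻¹ • μ) :=
    hint.smul_measure (by rw [hμu]; exact ENNReal.inv_ne_top.2 (volume_ball_ne_zero hρ ξ))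
  have h1 : ballAvg g ρ ξ - c = ∫ y, g y - c ∂((μ Set.univ)⁻¹ • μ) := by
    rw [integral_sub hint' (integrable_const c), ballAvg, average, integral_const, probReal_univ,
      one_smul]
  rw [h1]
  refine (enorm_integral_le_lintegral_enorm _).trans ?_
  rw [lintegral_smul_measure, smul_eq_mul, hμu, ← volume_ball_ratio hρ hR0 ξ, mul_assoc,
    ← setLIntegral_ball_eq hR0]
  refine mul_le_mul_right ?_ _
  rw [← lintegral_indicator measurableSet_ball (fun z => ‖g (x + z) - c‖ₑ)]
  calc ∫⁻ y, ‖g y - c‖ₑ ∂μ ≤ ∫⁻ y in ball x R, ‖g y - c‖ₑ := by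
        refine lintegral_mono_set (ball_subset_ball' ?_)
        linarith
    _ = ∫⁻ y, (ball x R).indicator (fun y => ‖g y - c‖ₑ) y :=
        (lintegral_indicator measurableSet_ball _).symm
    _ = ∫⁻ z, (ball x R).indicator (fun y => ‖g y - c‖ₑ) (x + z) :=
        (lintegral_add_left_eq_self _ x).symm
    _ = _ := by
        refine lintegral_congr fun z => ?_
        by_cases hz : z ∈ ball (0 : Euc d) R
        · rw [Set.indicator_of_mem hz, Set.indicator_of_mem]
          simpa [mem_ball, dist_eq_norm] using hz
        · rw [Set.indicator_of_notMem hz, Set.indicator_of_notMem]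
          simpa [mem_ball, dist_eq_norm] using hz

lemma exists_enorm_avgOp_sub_le (d : ℕ) {r : ℕ} (hr : 1 ≤ r) (T : ℝ) :
    ∃ C : NNReal, ∀ σ : ℝ, 0 < σ → ∀ g : Euc d → ℝ, LocallyIntegrable g → ∀ ξ x : Euc d,
      dist ξ x + 1 / (2 * σ) ≤ T * σ⁻¹ → ∀ c : ℝ, ‖avgOp g (1 / (2 * σ)) r ξ - c‖ₑ ≤
        C * ∫⁻ z, ‖g (x + z) - c‖ₑ ∂unifBall d (T * σ⁻¹) := by
  set e : ℕ → ℝ := fun j =>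
    -(2 / ((2 * r).choose r : ℝ)) * ((-1 : ℝ) ^ j * ((2 * r).choose (r - j) : ℝ)) with he
  refine ⟨∑ j ∈ Finset.Icc 1 r, ‖e j‖₊ * ((2 * r * T) ^ d).toNNReal, fun σ hσ g hg ξ x hx c => ?_⟩
  have hsum : ∑ j ∈ Finset.Icc 1 r, e j = 1 := by
    rw [← sum_avgOp_coeff hr, Finset.mul_sum]
  have hrep : avgOp g (1 / (2 * σ)) r ξ - c =
      ∑ j ∈ Finset.Icc 1 r, e j * (ballAvg g (1 / (2 * σ) * j / r) ξ - c) := by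
    simp_rw [mul_sub]
    rw [Finset.sum_sub_distrib, ← Finset.sum_mul, hsum, one_mul, avgOp, Finset.mul_sum]
    congr 1
    refine Finset.sum_congr rfl fun j _ => ?_
    simp only [he]
    ring
  have hr0 : (0 : ℝ) < r := by exact_mod_cast hr
  have hT : 0 < T := by
    have h1 : 0 < T * σ⁻¹ := by
      have : 0 < 1 / (2 * σ) := by positivity
      linarith [dist_nonneg (x := ξ) (y := x)]
    exact (pos_iff_pos_of_mul_pos h1).2 (by positivity)
  rw [hrep, ENNReal.ofNNReal_finsetSum, Finset.sum_mul]
  refine (enorm_sum_le _ _).trans (Finset.sum_le_sum fun j hj => ?_)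
  rw [Finset.mem_Icc] at hj
  have hj1 : (1 : ℝ) ≤ j := by exact_mod_cast hj.1
  have hjr : (j : ℝ) ≤ r := by exact_mod_cast hj.2
  have hρ : 0 < 1 / (2 * σ) * j / r := by positivity
  have hρ' : 1 / (2 * σ) * j / r ≤ 1 / (2 * σ) := by
    rw [mul_div_assoc]
    refine mul_le_of_le_one_right (by positivity) ?_
    rwa [div_le_one hr0]
  rw [enorm_mul, ENNReal.coe_mul, mul_assoc, enorm_eq_nnnorm]
  gcongr
  refine (enorm_ballAvg_sub_le (x := x) (R := T * σ⁻¹) hg hρ (by linarith) c).trans ?_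
  gcongr
  refine ENNReal.ofReal_le_ofReal ?_
  gcongr
  rw [div_le_iff₀ hρ]
  field_simp
  exact hj1

/-- Splines with coefficients close to local averages approximate the averaged function. -/
lemma exists_lpn_sub_spl_le (d : ℕ) {r : ℕ} (hr : 2 ≤ r) {p : ℝ} (hp : 1 ≤ p) :
    ∃ C : NNReal, ∀ σ : ℝ, 0 < σ → ∀ g : Euc d → ℝ, Measurable g → LocallyIntegrable g →
      ∀ a : (Fin d → ℤ) → ℝ, lpn p (fun x => ‖g x - spl r σ a x‖ₑ) ≤
        C * (smod p 1 g σ⁻¹ + gridNorm p σ fun k => avgOp g (1 / (2 * σ)) r (gridPt σ k) - a k) := by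
  obtain ⟨K, hK, -⟩ := exists_BsplineKer_bound d hr
  set T : ℕ := (2 * r + 1) * d + 1 with hT
  obtain ⟨C, hC⟩ := exists_enorm_avgOp_sub_le d (r := r) (by omega) (T : ℝ)
  refine ⟨K * ((splBox d r).card * (C * T + 1)), fun σ hσ g hgm hg a => ?_⟩
  have hT0 : 0 < (T : ℝ) * σ⁻¹ := by positivity
  have := isProbabilityMeasure_unifBall (d := d) hT0
  set A : (Fin d → ℤ) → ℝ := fun k => avgOp g (1 / (2 * σ)) r (gridPt σ k) with hA
  have hG : Measurable (Function.uncurry fun x z : Euc d => ‖g (x + z) - g x‖ₑ) := by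
    unfold Function.uncurry
    fun_prop
  have hGm : Measurable fun x => ∫⁻ z, ‖g (x + z) - g x‖ₑ ∂unifBall d (T * σ⁻¹) :=
    hG.lintegral_prod_right'
  set φ : Euc d → ℝ≥0∞ := fun x => C * ∫⁻ z, ‖g (x + z) - g x‖ₑ ∂unifBall d (T * σ⁻¹) with hφ
  have hφm : Measurable φ := hGm.const_mul _
  have hφn : lpn p φ ≤ C * (T * smod p 1 g σ⁻¹) := by
    refine lpn_le_mul_of_le_lintegral (unifBall d (T * σ⁻¹)) hp (fun x => le_rfl) hG ?_
    filter_upwards [ae_unifBall_norm_lt (d := d) (T * σ⁻¹)] with z hz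
    exact (lpn_sub_le_smod hp g hz).trans (smod_nat_mul_le hp hgm T)
  set ψ : (Fin d → ℤ) → Euc d → ℝ≥0∞ := fun m x =>
    ‖A (cellIdx σ x + m) - a (cellIdx σ x + m)‖ₑ with hψ
  have hψm : ∀ m, Measurable (ψ m) := fun m =>
    measurable_comp_cellIdx σ fun k => ‖A (k + m) - a (k + m)‖ₑ
  have hψn : ∀ m, lpn p (ψ m) = gridNorm p σ fun k => A k - a k := fun m =>
    lpn_cellIdx_add hσ (fun k => ‖A k - a k‖ₑ) m
  have hpt : ∀ x, ‖g x - spl r σ a x‖ₑ ≤ K * ∑ m ∈ splBox d r, (φ x + ψ m x) := by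
    intro x
    refine (enorm_sub_spl_le hr hK σ a x (g x)).trans ?_
    gcongr with m hm
    rw [show g x - a (cellIdx σ x + m) =
      (A (cellIdx σ x + m) - a (cellIdx σ x + m)) - (A (cellIdx σ x + m) - g x) by ring]
    refine enorm_sub_le.trans ?_
    rw [add_comm]
    gcongr
    refine hC σ hσ g hg _ x ?_ (g x)
    set ξ : Euc d := gridPt σ (cellIdx σ x + m)
    have hn : ‖(σ / (2 * r + 1)) • (ξ - x)‖ ≤ d := by
      refine norm_le_of_apply_le _ fun i => ?_
      have hmi : m i ∈ Finset.Icc (-(2 * r : ℕ) : ℤ) (2 * r : ℕ) :=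
        (Fintype.mem_piFinset.mp hm) i
      rw [Finset.mem_Icc] at hmi
      have h1 : -(2 * r : ℝ) ≤ m i := by exact_mod_cast hmi.1
      have h2 : (m i : ℝ) ≤ 2 * r := by exact_mod_cast hmi.2
      obtain ⟨h3, h4⟩ := cellIdx_mem σ x i
      have e : ((σ / (2 * r + 1)) • (ξ - x)) i =
          (m i - (σ * x i - cellIdx σ x i)) / (2 * r + 1) := by
        simp only [ξ, PiLp.smul_apply, PiLp.sub_apply, gridPt_apply, Pi.add_apply, smul_eq_mul]
        push_cast
        field_simp
        ring
      rw [e, abs_div, abs_of_pos (by positivity : (0 : ℝ) < 2 * r + 1), div_le_one (by positivity),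
        abs_le]
      constructor <;> linarith
    rw [norm_smul, Real.norm_eq_abs, abs_of_pos (by positivity), div_mul_eq_mul_div,
      div_le_iff₀ (by positivity)] at hn
    rw [dist_eq_norm]
    have hn2 : ‖ξ - x‖ ≤ d * (2 * r + 1) * σ⁻¹ := by
      rw [← div_eq_mul_inv, le_div_iff₀ hσ]; linarith
    have : 1 / (2 * σ) ≤ σ⁻¹ := by
      rw [one_div, mul_inv]
      exact mul_le_of_le_one_left (by positivity) (by norm_num)
    rw [hT]
    push_cast
    linarith
  have hsm : Measurable fun x => ∑ m ∈ splBox d r, (φ x + ψ m x) :=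
    Finset.measurable_fun_sum _ fun m _ => hφm.add (hψm m)
  refine (lpn_mono hp hpt).trans ?_
  rw [lpn_const_mul hp _ hsm]
  set N := gridNorm p σ fun k => A k - a k with hN
  have hfin : lpn p (fun x => ∑ m ∈ splBox d r, (φ x + ψ m x)) ≤
      (splBox d r).card * (C * (T * smod p 1 g σ⁻¹) + N) := by
    refine lpn_sum_le_card_mul hp _ (fun m => hφm.add (hψm m)) fun m _ => ?_
    refine (lpn_add_le hp hφm (hψm m)).trans ?_
    rw [hψn]
    gcongr
  push_cast
  rw [mul_assoc, mul_assoc]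
  gcongr
  refine hfin.trans ?_
  gcongr
  rw [mul_add, add_mul, add_mul, mul_assoc, one_mul, one_mul]
  gcongr
  · exact le_self_add
  · exact le_add_self

end averages

section discretization

variable {d : ℕ}

lemma gridPt_injective {σ : ℝ} (hσ : 0 < σ) : Function.Injective (gridPt (d := d) σ) := by
  intro k l h
  funext i
  have := congrArg (fun x : Euc d => x i) h
  simp only [gridPt_apply] at this
  rw [div_left_inj' hσ.ne'] at this
  exact_mod_cast this

lemma volume_cell {σ : ℝ} (hσ : 0 < σ) (k : Fin d → ℤ) :
    volume (cellIdx (d := d) σ ⁻¹' {k}) = (ENNReal.ofReal σ)⁻¹ ^ d := by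
  have hset : cellIdx (d := d) σ ⁻¹' {k} = (WithLp.ofLp : Euc d → Fin d → ℝ) ⁻¹'
      Set.univ.pi fun i => Set.Ico (k i / σ) ((k i + 1) / σ) := by
    ext x
    simp only [Set.mem_preimage, Set.mem_singleton_iff, cellIdx, funext_iff, Int.floor_eq_iff,
      Set.mem_univ_pi, Set.mem_Ico, div_le_iff₀' hσ, lt_div_iff₀' hσ]
  rw [hset, (PiLp.volume_preserving_ofLp (Fin d)).measure_preimage
    (MeasurableSet.univ_pi fun _ => measurableSet_Ico).nullMeasurableSet, Real.volume_pi_Ico]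
  simp_rw [← sub_div, add_sub_cancel_left, one_div]
  simp [ENNReal.ofReal_inv_of_pos hσ]

lemma lpX_range_gridPt {p σ : ℝ} (hp : 1 ≤ p) (hσ : 0 < σ) (F : Euc d → ℝ) :
    lpX p σ (Set.range (gridPt (d := d) σ)) F = gridNorm p σ fun k => F (gridPt σ k) := by
  rw [lpX, gridNorm, lpn]
  congr 1
  rw [tsum_range (fun ξ : Euc d => ENNReal.ofReal (|F ξ| ^ p)) (gridPt_injective hσ)]
  have h := lintegral_map (μ := (volume : Measure (Euc d)))
    (f := fun k : Fin d → ℤ => ‖F (gridPt σ k)‖ₑ ^ p) (measurable_of_countable _)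
    (measurable_cellIdx σ)
  rw [← h, lintegral_countable', mul_comm, ← ENNReal.tsum_mul_right]
  refine tsum_congr fun k => ?_
  rw [Measure.map_apply (measurable_cellIdx σ) (measurableSet_singleton k), volume_cell hσ,
    ← ENNReal.ofReal_rpow_of_nonneg (abs_nonneg _) (by linarith), ← Real.enorm_eq_ofReal_abs]

lemma norm_gridPt_le {r : ℕ} {σ : ℝ} (hσ : 0 < σ) {m : Fin d → ℤ} (hm : m ∈ splBox d r) :
    ‖gridPt σ m‖ < (2 * r * d + 1 : ℕ) * σ⁻¹ := by
  rcases Nat.eq_zero_or_pos r with rfl | hr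
  · have h0 : gridPt σ m = 0 := by
      ext i
      have hmi := (Fintype.mem_piFinset.mp hm) i
      simp at hmi
      simp [hmi]
    rw [h0, norm_zero]
    positivity
  have hr' : (0 : ℝ) < r := by exact_mod_cast hr
  have hn : ‖(σ / (2 * r)) • gridPt σ m‖ ≤ d := by
    refine norm_le_of_apply_le _ fun i => ?_
    have hmi := (Fintype.mem_piFinset.mp hm) i
    rw [Finset.mem_Icc] at hmi
    have h1 : -(2 * r : ℝ) ≤ m i := by exact_mod_cast hmi.1
    have h2 : (m i : ℝ) ≤ 2 * r := by exact_mod_cast hmi.2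
    have e : ((σ / (2 * r)) • gridPt σ m) i = m i / (2 * r) := by
      simp only [PiLp.smul_apply, gridPt_apply, smul_eq_mul]
      field_simp
    rw [e, abs_div, abs_of_pos (by positivity : (0 : ℝ) < 2 * r), div_le_one (by positivity),
      abs_le]
    exact ⟨h1, h2⟩
  rw [norm_smul, Real.norm_eq_abs, abs_of_pos (by positivity), div_mul_eq_mul_div,
    div_le_iff₀ (by positivity)] at hn
  rw [← div_eq_mul_inv, lt_div_iff₀ hσ]
  push_cast
  linarith

/-- Smoothness at a small scale, estimated through the error of spline approximation. -/
lemma exists_smod_mul_le (d : ℕ) {r : ℕ} (hr : 2 ≤ r) {p : ℝ} (hp : 1 ≤ p) :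
    ∃ C : NNReal, ∀ σ : ℝ, 0 < σ → ∀ g : Euc d → ℝ, Measurable g → ∀ a : (Fin d → ℤ) → ℝ,
      ∀ ε : NNReal, ε ≤ 1 → smod p 1 g (ε * σ⁻¹) ≤
        C * lpn p (fun x => ‖g x - spl r σ a x‖ₑ) + C * ε * smod p 1 g σ⁻¹ := by
  obtain ⟨K, -, hK⟩ := exists_BsplineKer_bound d hr
  obtain ⟨S, hS⟩ := exists_gridNorm_le d hr hp
  set T : ℕ := 2 * r * d + 1 with hT
  set n := (splBox d r).card with hn
  refine ⟨2 + K * n * S * (2 + T), fun σ hσ g hg a ε hε => ?_⟩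
  have hs := measurable_spl (d := d) hr σ a
  set s := spl r σ a with hsdef
  set E := lpn p fun x => ‖g x - s x‖ₑ with hE
  have hgs : Measurable fun x => g x - s x := hg.sub hs
  have hshift : ∀ u : Euc d, lpn p (fun x => ‖(g (x + u) - s (x + u)) - (g x - s x)‖ₑ) ≤ 2 * E := by
    intro u
    refine (lpn_enorm_sub_le hp (hgs.comp (measurable_id.add_const u)) hgs).trans_eq ?_
    rw [two_mul, hE]
    congr 1
    exact lpn_comp_add (fun x => ‖g x - s x‖ₑ) u
  have hcoef : ∀ m ∈ splBox d r, lpn p (fun x => ‖a (cellIdx σ x + m) - a (cellIdx σ x)‖ₑ) ≤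
      S * (2 * E + T * smod p 1 g σ⁻¹) := by
    intro m hm
    refine (hS σ hσ fun k => a (k + m) - a k).trans ?_
    gcongr
    simp_rw [spl_sub hr, ← spl_add_gridPt r hσ]
    set u : Euc d := gridPt σ m
    refine (lpn_mono hp (ψ := fun x => ‖(g (x + u) - s (x + u)) - (g x - s x)‖ₑ +
      ‖g (x + u) - g x‖ₑ) fun x => ?_).trans ((lpn_add_le hp ?_ ?_).trans ?_)
    · rw [show s (x + u) - s x = (g (x + u) - g x) - ((g (x + u) - s (x + u)) - (g x - s x)) by ring]
      exact enorm_sub_le.trans_eq (add_comm _ _)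
    · fun_prop
    · fun_prop
    · gcongr
      · exact hshift u
      · exact (lpn_sub_le_smod hp g (norm_gridPt_le hσ hm)).trans (smod_nat_mul_le hp hg T)
  refine smod_one_le hp fun h hh => ?_
  have hσh : ‖σ • h‖ₑ ≤ ε := by
    rw [enorm_eq_nnnorm, ENNReal.coe_le_coe, ← NNReal.coe_le_coe, coe_nnnorm, norm_smul,
      Real.norm_eq_abs, abs_of_pos hσ]
    rw [← div_eq_mul_inv, lt_div_iff₀ hσ] at hh
    linarith
  have hσh1 : ‖σ • h‖ ≤ 1 := by
    rw [enorm_eq_nnnorm, ENNReal.coe_le_coe] at hσh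
    exact_mod_cast hσh.trans hε
  have hcm : ∀ m : Fin d → ℤ, Measurable fun x : Euc d =>
      ‖a (cellIdx σ x + m) - a (cellIdx σ x)‖ₑ := fun m =>
    measurable_comp_cellIdx σ fun k => ‖a (k + m) - a k‖ₑ
  have hsm : Measurable fun x : Euc d =>
      ∑ m ∈ splBox d r, ‖a (cellIdx σ x + m) - a (cellIdx σ x)‖ₑ :=
    Finset.measurable_fun_sum _ fun m _ => hcm m
  have hΔ : lpn p (fun x => ‖s (x + h) - s x‖ₑ) ≤
      K * ε * (n * (S * (2 * E + T * smod p 1 g σ⁻¹))) := by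
    refine (lpn_mono hp (ψ := fun x => K * ε *
      ∑ m ∈ splBox d r, ‖a (cellIdx σ x + m) - a (cellIdx σ x)‖ₑ) fun x => ?_).trans ?_
    · refine (enorm_spl_add_sub_le hr hK a x hσh1).trans ?_
      gcongr
    · rw [lpn_const_mul hp _ hsm]
      gcongr
      exact lpn_sum_le_card_mul hp _ hcm hcoef
  have hmain : lpn p (fun x => ‖g (x + h) - g x‖ₑ) ≤
      2 * E + K * ε * (n * (S * (2 * E + T * smod p 1 g σ⁻¹))) := by
    refine (lpn_mono hp (ψ := fun x => ‖(g (x + h) - s (x + h)) - (g x - s x)‖ₑ +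
      ‖s (x + h) - s x‖ₑ) fun x => ?_).trans ((lpn_add_le hp ?_ ?_).trans ?_)
    · rw [show g (x + h) - g x = ((g (x + h) - s (x + h)) - (g x - s x)) + (s (x + h) - s x) by ring]
      exact enorm_add_le _ _
    · fun_prop
    · fun_prop
    · gcongr
      exact hshift h
  refine hmain.trans ?_
  set w := smod p 1 g σ⁻¹
  have hε' : (ε : ℝ≥0∞) ≤ 1 := by exact_mod_cast hε
  push_cast
  calc 2 * E + K * ε * (n * (S * (2 * E + T * w)))
      = 2 * E + (K * n * S * 2) * (ε * E) + K * n * S * T * ε * w := by ring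
    _ ≤ 2 * E + (K * n * S * 2) * (1 * E) + K * n * S * T * ε * w := by gcongr
    _ ≤ 2 * E + (K * n * S * 2) * (1 * E) + K * n * S * T * ε * w +
        (K * n * S * T * E + (2 + K * n * S * 2) * ε * w) := le_self_add
    _ = (2 + K * n * S * (2 + T)) * E + (2 + K * n * S * (2 + T)) * ε * w := by ring

end discretization

lemma exists_rpow_decay {V : ℝ → ℝ} (hmono : Monotone V) (hV : ∀ δ, 0 ≤ V δ) {A C σ₀ α : ℝ}
    (hC : 0 ≤ C) (hσ₀ : 0 < σ₀) (hα0 : 0 < α) (hα1 : α < 1)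
    (h : ∀ σ, σ₀ ≤ σ → ∀ ε, 0 < ε → ε ≤ 1 →
      V (ε * σ⁻¹) ≤ A * σ ^ (-α) + C * ε * V σ⁻¹) :
    ∃ D, 0 ≤ D ∧ ∀ σ, σ₀ ≤ σ → V σ⁻¹ ≤ D * σ ^ (-α) := by
  set q : ℝ := 1 / (2 * (C + 1)) with hq
  have hq0 : 0 < q := by positivity
  have hq1 : q < 1 := by rw [hq, div_lt_one (by positivity)]; linarith
  have hα' : 0 < 1 - α := by linarith
  set ε : ℝ := q ^ (1 / (1 - α)) with hε
  have hε0 : 0 < ε := Real.rpow_pos_of_pos hq0 _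
  have hε1 : ε < 1 := Real.rpow_lt_one hq0.le hq1 (by positivity)
  have hεq : ε = q * ε ^ α := by
    have : ε ^ (1 - α) = q := by
      rw [hε, ← Real.rpow_mul hq0.le, one_div_mul_cancel hα'.ne', Real.rpow_one]
    rw [← this, ← Real.rpow_add hε0]
    simp
  have hεα : 0 < ε ^ α := Real.rpow_pos_of_pos hε0 _
  have hCε : C * ε ≤ ε ^ α / 2 := by
    have hCq : C * q ≤ 1 / 2 := by
      rw [hq, mul_one_div, div_le_div_iff₀ (by positivity) (by norm_num)]; linarith
    calc C * ε = C * q * ε ^ α := by rw [mul_assoc, ← hεq]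
      _ ≤ 1 / 2 * ε ^ α := by gcongr
      _ = ε ^ α / 2 := by ring
  set D := max (V σ₀⁻¹) (2 * (A * σ₀ ^ (-α)) / ε ^ α) with hD
  have hD0 : 0 ≤ D := (hV _).trans (le_max_left _ _)
  have hAD : A * σ₀ ^ (-α) ≤ D * (ε ^ α / 2) := by
    have : 2 * (A * σ₀ ^ (-α)) / ε ^ α ≤ D := le_max_right _ _
    rw [div_le_iff₀ hεα] at this
    linarith
  have hind : ∀ n : ℕ, V (ε ^ n * σ₀⁻¹) ≤ D * (ε ^ n) ^ α := by
    intro n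
    induction n with
    | zero => simp [hD]
    | succ n ih =>
      have hn0 : 0 < ε ^ n := pow_pos hε0 n
      have hn1 : ε ^ n ≤ 1 := pow_le_one₀ hε0.le hε1.le
      have h1 := h (σ₀ * (ε ^ n)⁻¹) (le_mul_of_one_le_right hσ₀.le ((one_le_inv₀ hn0).2 hn1))
        ε hε0 hε1.le
      have e1 : (σ₀ * (ε ^ n)⁻¹)⁻¹ = ε ^ n * σ₀⁻¹ := by rw [mul_inv, inv_inv, mul_comm]
      have e2 : (σ₀ * (ε ^ n)⁻¹) ^ (-α) = σ₀ ^ (-α) * (ε ^ n) ^ α := by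
        rw [Real.mul_rpow hσ₀.le (by positivity), Real.inv_rpow hn0.le, Real.rpow_neg hn0.le, inv_inv]
      rw [e1, e2, ← mul_assoc ε, ← pow_succ', ← mul_assoc] at h1
      have hnα : 0 ≤ (ε ^ n) ^ α := by positivity
      calc V (ε ^ (n + 1) * σ₀⁻¹)
          ≤ A * σ₀ ^ (-α) * (ε ^ n) ^ α + C * ε * V (ε ^ n * σ₀⁻¹) := h1
        _ ≤ D * (ε ^ α / 2) * (ε ^ n) ^ α + ε ^ α / 2 * (D * (ε ^ n) ^ α) := by
            have := hV (ε ^ n * σ₀⁻¹)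
            gcongr
        _ = D * (ε ^ n * ε) ^ α := by rw [Real.mul_rpow hn0.le hε0.le]; ring
        _ = D * (ε ^ (n + 1)) ^ α := by rw [pow_succ]
  refine ⟨D * (ε ^ α)⁻¹ * σ₀ ^ α, by positivity, fun σ hσ => ?_⟩
  have hσ0 : 0 < σ := hσ₀.trans_le hσ
  obtain ⟨n, hn1, hn2⟩ := exists_nat_pow_near_of_lt_one (x := σ₀ / σ) (by positivity)
    ((div_le_one hσ0).2 hσ) hε0 hε1
  calc V σ⁻¹ = V (σ₀ / σ * σ₀⁻¹) := by congr 1; field_simp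
    _ ≤ V (ε ^ n * σ₀⁻¹) := hmono (by gcongr)
    _ ≤ D * (ε ^ n) ^ α := hind n
    _ = D * (ε ^ α)⁻¹ * (ε ^ (n + 1)) ^ α := by
        rw [pow_succ, Real.mul_rpow (by positivity) hε0.le]; field_simp
    _ ≤ D * (ε ^ α)⁻¹ * (σ₀ / σ) ^ α := by gcongr
    _ = D * (ε ^ α)⁻¹ * σ₀ ^ α * σ ^ (-α) := by
        rw [Real.div_rpow hσ₀.le hσ0.le, Real.rpow_neg hσ0.le]; ring

section representative

variable {d : ℕ} {f g : Euc d → ℝ}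

lemma avgOp_congr_ae (h : f =ᵐ[volume] g) (δ : ℝ) (r : ℕ) : avgOp f δ r = avgOp g δ r := by
  funext x
  have : ∀ ρ, ballAvg f ρ x = ballAvg g ρ x := fun ρ => average_congr (ae_restrict_of_ae h)
  simp_rw [avgOp, this]

lemma smod_one_congr_ae (h : f =ᵐ[volume] g) (p δ : ℝ) : smod p 1 f δ = smod p 1 g δ := by
  refine iSup_congr fun u => iSup_congr fun _ => eLpNorm_congr_ae ?_
  have hu := (measurePreserving_add_right volume u).quasiMeasurePreserving.ae_eq_comp h
  filter_upwards [h, hu] with x h1 h2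
  rw [diffOp_one, diffOp_one, h1]
  simpa using h2

lemma LpN_sub_congr_ae {p : ℝ} (hp : 1 ≤ p) (h : f =ᵐ[volume] g) (s : Euc d → ℝ) :
    LpN p (f - s) = lpn p fun x => ‖g x - s x‖ₑ := by
  have : LpN p (f - s) = LpN p (g - s) := eLpNorm_congr_ae (h.sub EventuallyEq.rfl)
  rw [this, LpN_eq_lpn hp]
  rfl

end representative

/-- The order of spline approximation bounds the order of decay of the modulus of continuity. -/
lemma bigO_smod_one {d : ℕ} {r : ℕ} (hr : 2 ≤ r) {p : ℝ} (hp : 1 ≤ p) {α : ℝ} (hα0 : 0 < α)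
    (hα1 : α < 1) {g : Euc d → ℝ} (hg : Measurable g) (hgp : LpN p g ≠ ∞)
    (a : ℝ → (Fin d → ℤ) → ℝ)
    (h : BigO (fun σ => lpn p fun x => ‖g x - spl r σ (a σ) x‖ₑ) α) :
    BigO (fun σ => smod p 1 g σ⁻¹) α := by
  obtain ⟨A, hA, hev⟩ := h
  obtain ⟨C, hC⟩ := exists_smod_mul_le d hr hp
  obtain ⟨σ₁, hσ₁⟩ := eventually_atTop.1 hev
  set σ₀ := max σ₁ 1 with hσ₀
  have hσ₀0 : 0 < σ₀ := lt_max_of_lt_right one_pos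
  have hfin : ∀ δ, smod p 1 g δ ≠ ∞ := fun δ =>
    ((smod_one_le_two_mul hp hg δ).trans_lt (ENNReal.mul_lt_top (by simp) hgp.lt_top)).ne
  obtain ⟨D, hD0, hD⟩ := exists_rpow_decay (V := fun δ => (smod p 1 g δ).toReal) (σ₀ := σ₀)
    (A := C * A.toReal) (C := C) (α := α)
    (fun x y hxy => ENNReal.toReal_mono (hfin y) (smod_mono g hxy))
    (fun δ => ENNReal.toReal_nonneg) C.2 hσ₀0 hα0 hα1 (by
      intro σ hσ ε hε0 hε1
      have hσ0 : 0 < σ := hσ₀0.trans_le hσ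
      lift ε to NNReal using hε0.le
      have h1 : smod p 1 g (ε * σ⁻¹) ≤
          C * (A * ENNReal.ofReal (σ ^ (-α))) + C * ε * smod p 1 g σ⁻¹ := by
        refine (hC σ hσ0 g hg (a σ) ε (by exact_mod_cast hε1)).trans ?_
        gcongr
        exact hσ₁ σ ((le_max_left _ _).trans hσ)
      have t1 : C * (A * ENNReal.ofReal (σ ^ (-α))) ≠ ∞ :=
        ENNReal.mul_ne_top ENNReal.coe_ne_top (ENNReal.mul_ne_top hA ENNReal.ofReal_ne_top)
      have t2 : C * ε * smod p 1 g σ⁻¹ ≠ ∞ :=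
        ENNReal.mul_ne_top (ENNReal.mul_ne_top ENNReal.coe_ne_top ENNReal.coe_ne_top) (hfin _)
      have h2 := ENNReal.toReal_mono (ENNReal.add_ne_top.2 ⟨t1, t2⟩) h1
      rw [ENNReal.toReal_add t1 t2] at h2
      simp only [ENNReal.toReal_mul, ENNReal.coe_toReal] at h2
      rwa [ENNReal.toReal_ofReal (Real.rpow_nonneg hσ0.le _), ← mul_assoc] at h2)
  refine ⟨ENNReal.ofReal D, ENNReal.ofReal_ne_top, eventually_atTop.2 ⟨σ₀, fun σ hσ => ?_⟩⟩
  rw [← ENNReal.ofReal_mul hD0]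
  exact ENNReal.le_ofReal_iff_toReal_le (hfin σ⁻¹)
    (mul_nonneg hD0 (Real.rpow_nonneg (hσ₀0.le.trans hσ) _)) |>.2 (hD σ hσ)

/-- Corollary 6.4: for the B-spline sampling operator `S_σ^{β_r}` with `r ≥ 2` and
`α ∈ (0,1)`, the conditions (i) `‖f - S_σ^{β_r} f‖_p = O(σ^{-α})` and
(ii) `‖f_{1/(2σ),r} - f‖_{ℓ_p(X_σ)} + ω_1(f,σ⁻¹)_p = O(σ^{-α})` are equivalent. -/
theorem statement18 (d : ℕ) (hd : 1 ≤ d) (p : ℝ) (hp : 1 ≤ p)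
    (r : ℕ) (hr : 2 ≤ r) (α : ℝ) (hα0 : 0 < α) (hα1 : α < 1)
    (f : Euc d → ℝ) (hf : MemLpR p f)
    (hsum : ∀ σ : ℝ, 0 < σ → Summable (fun k : Fin d → ℤ => |f (gridPt σ k)| ^ p)) :
    BigO (fun σ : ℝ => LpN p (f - samplingOp (BsplineKer r) σ f)) α ↔
      BigO (fun σ : ℝ =>
        lpX p σ (Set.range (gridPt (d := d) σ)) (avgOp f (1 / (2 * σ)) r - f) +
          smod p 1 f σ⁻¹) α := by
  have hp1 : 1 ≤ ENNReal.ofReal p := by simpa using hp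
  set g := hf.1.mk f with hgdef
  have hfg : f =ᵐ[volume] g := hf.1.ae_eq_mk
  have hg : Measurable g := hf.1.stronglyMeasurable_mk.measurable
  have hgp : LpN p g ≠ ∞ := by
    have : LpN p g = LpN p f := (eLpNorm_congr_ae hfg).symm
    rw [this]
    exact hf.2
  have hgl : LocallyIntegrable g :=
    MemLp.locallyIntegrable ⟨hg.aestronglyMeasurable, hgp.lt_top⟩ hp1
  have hE : ∀ σ : ℝ, LpN p (f - samplingOp (BsplineKer r) σ f) =
      lpn p fun x => ‖g x - spl r σ (fun k => f (gridPt σ k)) x‖ₑ := fun σ =>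
    LpN_sub_congr_ae hp hfg _
  have hN : ∀ σ : ℝ, 0 < σ →
      lpX p σ (Set.range (gridPt (d := d) σ)) (avgOp f (1 / (2 * σ)) r - f) =
      gridNorm p σ fun k => avgOp g (1 / (2 * σ)) r (gridPt σ k) - f (gridPt σ k) := by
    intro σ hσ
    rw [lpX_range_gridPt hp hσ, avgOp_congr_ae hfg]
    rfl
  obtain ⟨C, hC⟩ := exists_lpn_sub_spl_le d hr hp
  obtain ⟨S, hS⟩ := exists_gridNorm_le d hr hp
  simp_rw [hE, smod_one_congr_ae hfg]
  constructor
  · intro h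
    obtain ⟨D, hD, hDev⟩ := bigO_smod_one hr hp hα0 hα1 hg hgp _ h
    obtain ⟨A, hA, hAev⟩ := h
    refine ⟨S * (A + C * D) + D, ?_, ?_⟩
    · exact ENNReal.add_ne_top.2 ⟨ENNReal.mul_ne_top ENNReal.coe_ne_top
        (ENNReal.add_ne_top.2 ⟨hA, ENNReal.mul_ne_top ENNReal.coe_ne_top hD⟩), hD⟩
    filter_upwards [hDev, hAev, eventually_gt_atTop 0] with σ h1 h2 hσ
    rw [hN σ hσ]
    set ρ := ENNReal.ofReal (σ ^ (-α))
    set b : (Fin d → ℤ) → ℝ := fun k => f (gridPt σ k)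
    set a : (Fin d → ℤ) → ℝ := fun k => avgOp g (1 / (2 * σ)) r (gridPt σ k) with ha
    have hCa : lpn p (fun x => ‖g x - spl r σ a x‖ₑ) ≤ C * (D * ρ) := by
      have h0 : gridNorm p σ (fun k => a k - a k) = 0 := by
        simp [gridNorm, lpn, show 0 < p by linarith]
      refine (hC σ hσ g hg hgl a).trans ?_
      rw [h0, add_zero]
      gcongr
    have hab : gridNorm p σ (fun k => a k - b k) ≤ S * (A * ρ + C * (D * ρ)) := by
      refine (hS σ hσ _).trans ?_
      gcongr
      simp_rw [spl_sub hr]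
      have e : ∀ x, spl r σ a x - spl r σ b x = (g x - spl r σ b x) - (g x - spl r σ a x) :=
        fun x => by ring
      simp_rw [e]
      exact (lpn_enorm_sub_le hp (hg.sub (measurable_spl hr σ b))
        (hg.sub (measurable_spl hr σ a))).trans (add_le_add h2 hCa)
    calc gridNorm p σ (fun k => a k - b k) + smod p 1 g σ⁻¹
        ≤ S * (A * ρ + C * (D * ρ)) + D * ρ := add_le_add hab h1
      _ = (S * (A + C * D) + D) * ρ := by ring
  · rintro ⟨A, hA, hev⟩
    refine ⟨C * A, ENNReal.mul_ne_top ENNReal.coe_ne_top hA, ?_⟩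
    filter_upwards [hev, eventually_gt_atTop 0] with σ h1 hσ
    rw [hN σ hσ] at h1
    refine (hC σ hσ g hg hgl _).trans ?_
    rw [mul_assoc, add_comm]
    gcongr
end
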